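/- Let u and B be as in the context and set γ = (1/r)·⨍_{∂B(x₀,r)} u for a ball B_r = B(x₀,r) ⊂ B. Then there is a constant C, depending only on a, d, D, u and B (but not on x₀ or r), such that ‖u‖_{L^∞(B(x₀,r/2))} ≤ C(γ r + r²). -/

import Mathlib

open MeasureTheory Filter Metric Set
open scoped RealInnerProductSpace ENNReal Topology NNReal

noncomputable section

abbrev Euc (d : ℕ) := EuclideanSpace ℝ (Fin d)

variable {d : ℕ}

/-- Real-valued Lebesgue volume of a set. -/
def mvol (s : Set (Euc d)) : ℝ := (volume s).toReal

/-- Smooth scalar test function compactly supported in `Ω`. -/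
def TestFun (Ω : Set (Euc d)) (φ : Euc d → ℝ) : Prop :=
  ContDiff ℝ (⊤ : ℕ∞) φ ∧ HasCompactSupport φ ∧ tsupport φ ⊆ Ω

/-- Smooth vector field compactly supported in `Ω`. -/
def VecTestFun (Ω : Set (Euc d)) (Φ : Euc d → Euc d) : Prop :=
  ContDiff ℝ (⊤ : ℕ∞) Φ ∧ HasCompactSupport Φ ∧ tsupport Φ ⊆ Ω

/-- Membership in `H¹₀(Ω)`, encoded through `L²` integrability of the function and of its
(a.e. defined) gradient, together with approximation in the `H¹` norm by smooth functions
compactly supported in `Ω`. -/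
def MemH10 (Ω : Set (Euc d)) (v : Euc d → ℝ) : Prop :=
  MemLp v 2 (volume : Measure (Euc d)) ∧
  MemLp (fun x => gradient v x) 2 (volume : Measure (Euc d)) ∧
  ∃ φ : ℕ → Euc d → ℝ, (∀ n, TestFun Ω (φ n)) ∧
    Tendsto (fun n => ∫ x, ((v x - φ n x) ^ 2 + ‖gradient v x - gradient (φ n) x‖ ^ 2))
      atTop (nhds 0)

/-- First Dirichlet eigenvalue of `Ω`, via the Rayleigh quotient variational characterization. -/
def lam1 (Ω : Set (Euc d)) : ℝ :=
  sInf {t : ℝ | ∃ v : Euc d → ℝ, MemH10 Ω v ∧ (∫ x, (v x) ^ 2) = 1 ∧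
    t = ∫ x, ‖gradient v x‖ ^ 2}

/-- `u` is a normalized first Dirichlet eigenfunction of `Ω`. -/
def IsFirstEigenfun (Ω : Set (Euc d)) (u : Euc d → ℝ) : Prop :=
  MemH10 Ω u ∧ (∫ x, (u x) ^ 2) = 1 ∧ (∫ x, ‖gradient u x‖ ^ 2) = lam1 Ω ∧
  ∀ φ : Euc d → ℝ, TestFun Ω φ →
    (∫ x, ⟪gradient u x, gradient φ x⟫) = lam1 Ω * ∫ x, u x * φ x

/-- `Ω` solves the shape optimization problem: it minimizes `λ₁` among open subsets of `D` of
measure `a`. -/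
structure IsOptimalShape (D : Set (Euc d)) (a : ℝ) (Ω : Set (Euc d)) : Prop where
  isOpen : IsOpen Ω
  subset : Ω ⊆ D
  meas : mvol Ω = a
  minim : ∀ Ω' : Set (Euc d), IsOpen Ω' → Ω' ⊆ D → mvol Ω' = a → lam1 Ω ≤ lam1 Ω'

/-- `u` is locally Lipschitz continuous in `s`. -/
def LocLipOn (s : Set (Euc d)) (u : Euc d → ℝ) : Prop :=
  ∀ x ∈ s, ∃ t, t ∈ 𝓝 x ∧ t ⊆ s ∧ ∃ K : ℝ≥0, LipschitzOnWith K u t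

/-- Divergence of a vector field. -/
def divg (Φ : Euc d → Euc d) (x : Euc d) : ℝ :=
  ∑ i, fderiv ℝ Φ x (EuclideanSpace.single i 1) i

/-- `Ω` has locally finite perimeter in `D` (its characteristic function has locally bounded
variation in `D`). -/
def HasLocFinPerimeterIn (D Ω : Set (Euc d)) : Prop :=
  ∀ K : Set (Euc d), IsCompact K → K ⊆ D → ∃ C : ℝ,
    ∀ Φ : Euc d → Euc d, VecTestFun K Φ → (∀ x, ‖Φ x‖ ≤ 1) →
      (∫ x in Ω, divg Φ x) ≤ C

/-- The reduced boundary of `Ω`: points where `Ω` blows up to a half space, in the sense that the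
symmetric difference with a half space is of vanishing density. -/
def reducedBoundary (Ω : Set (Euc d)) : Set (Euc d) :=
  {x | ∃ ν : Euc d, ‖ν‖ = 1 ∧
    Tendsto (fun r : ℝ =>
        volume (symmDiff (Ω ∩ ball x r) ({y | ⟪y - x, ν⟫ ≤ 0} ∩ ball x r)) /
          ENNReal.ofReal (r ^ d))
      (𝓝[>] 0) (𝓝 0)}

/-- `S` is an analytic hypersurface in `D`: near each of its points in `D` it is the zero set of
an analytic function with nonvanishing gradient. -/
def IsAnalyticHypersurfaceIn (D S : Set (Euc d)) : Prop :=
  ∀ x ∈ S ∩ D, ∃ U : Set (Euc d), IsOpen U ∧ x ∈ U ∧ U ⊆ D ∧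
    ∃ f : Euc d → ℝ, AnalyticOn ℝ f U ∧ (∀ y ∈ U, fderiv ℝ f y ≠ 0) ∧
      S ∩ U = {y ∈ U | f y = 0}

/-- The functional `J(v) = ∫ |∇v|² - λ ∫ v²`. -/
def Jfun (lam : ℝ) (v : Euc d → ℝ) : ℝ :=
  (∫ x, ‖gradient v x‖ ^ 2) - lam * ∫ x, (v x) ^ 2

/-- `Ω_v = {x ∈ D : v(x) ≠ 0}`. -/
def Om (D : Set (Euc d)) (v : Euc d → ℝ) : Set (Euc d) := {x ∈ D | v x ≠ 0}

/-- The optimal value `λ_a` of `λ₁` among open subsets of `D` of measure `a`. -/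
def lamOpt (D : Set (Euc d)) (a : ℝ) : ℝ :=
  sInf {t : ℝ | ∃ Ω : Set (Euc d), IsOpen Ω ∧ Ω ⊆ D ∧ mvol Ω = a ∧ t = lam1 Ω}

/-- `u` minimizes `J` among functions of `H¹₀(D)` with `|Ω_w| ≤ a`. -/
def IsJMinimizer (D : Set (Euc d)) (a lam : ℝ) (u : Euc d → ℝ) : Prop :=
  MemH10 D u ∧ mvol (Om D u) ≤ a ∧
  ∀ w : Euc d → ℝ, MemH10 D w → mvol (Om D w) ≤ a → Jfun lam u ≤ Jfun lam w

/-- The class `F` of perturbations of `u` supported in `B`. -/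
def Fcal (D B : Set (Euc d)) (u v : Euc d → ℝ) : Prop :=
  MemH10 D v ∧ MemH10 B (fun x => u x - v x)

/-- The set of penalization constants `μ₋` admissible for `h` (inward perturbations). -/
def Mminus (D : Set (Euc d)) (a lam : ℝ) (u : Euc d → ℝ) (B : Set (Euc d)) (h : ℝ) :
    Set ℝ :=
  {μ : ℝ | 0 ≤ μ ∧ ∀ v : Euc d → ℝ, Fcal D B u v →
    a - h ≤ mvol (Om D v) → mvol (Om D v) ≤ a →
    Jfun lam u + μ * mvol (Om D u) ≤ Jfun lam v + μ * mvol (Om D v)}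

/-- The set of penalization constants `μ₊` admissible for `h` (outward perturbations). -/
def Mplus (D : Set (Euc d)) (a lam : ℝ) (u : Euc d → ℝ) (B : Set (Euc d)) (h : ℝ) :
    Set ℝ :=
  {μ : ℝ | 0 ≤ μ ∧ ∀ v : Euc d → ℝ, Fcal D B u v →
    a ≤ mvol (Om D v) → mvol (Om D v) ≤ a + h →
    Jfun lam u + μ * mvol (Om D u) ≤ Jfun lam v + μ * mvol (Om D v)}

/-- `μ₋(h)`: the biggest admissible inward penalization constant. -/
def muMinus (D : Set (Euc d)) (a lam : ℝ) (u : Euc d → ℝ) (B : Set (Euc d)) (h : ℝ) : ℝ :=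
  sSup (Mminus D a lam u B h)

/-- `μ₊(h)`: the smallest admissible outward penalization constant. -/
def muPlus (D : Set (Euc d)) (a lam : ℝ) (u : Euc d → ℝ) (B : Set (Euc d)) (h : ℝ) : ℝ :=
  sInf (Mplus D a lam u B h)

/-- Average of `u` on the sphere `∂B(x,r)`, with respect to the `(d-1)`-Hausdorff measure. -/
def sphAvg (u : Euc d → ℝ) (x : Euc d) (r : ℝ) : ℝ :=
  (∫ y in sphere x r, u y ∂(μH[(d : ℝ) - 1])) / ((μH[(d : ℝ) - 1]) (sphere x r)).toReal

instance instCStar (d : ℕ) : ContinuousStar (Euc d →L[ℝ] Euc d) :=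
  ⟨(ContinuousLinearMap.adjoint (𝕜 := ℝ) (E := Euc d) (F := Euc d)).continuous⟩

abbrev Gd (d : ℕ) := ↥(unitary (Euc d →L[ℝ] Euc d))

instance instMSGd (d : ℕ) : MeasurableSpace (Gd d) := borel _
instance instBSGd (d : ℕ) : BorelSpace (Gd d) := ⟨rfl⟩

instance instCSGd (d : ℕ) : CompactSpace (Gd d) := by
  refine (isCompact_iff_compactSpace (s := (unitary (Euc d →L[ℝ] Euc d) : Set (Euc d →L[ℝ] Euc d)))).1 ?_
  haveI : ProperSpace (Euc d →L[ℝ] Euc d) := FiniteDimensional.proper ℝ _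
  apply Metric.isCompact_of_isClosed_isBounded
  · exact isClosed_unitary
  · refine (Metric.isBounded_closedBall (x := (0 : Euc d →L[ℝ] Euc d)) (r := 1)).subset ?_
    intro g hg
    rw [mem_closedBall_zero_iff]
    refine ContinuousLinearMap.opNorm_le_bound _ zero_le_one fun x => ?_
    have := (Unitary.linearIsometryEquiv (⟨g, hg⟩ : Gd d)).norm_map x
    have h2 : (Unitary.linearIsometryEquiv (⟨g, hg⟩ : Gd d)) x = g x := rfl
    rw [h2] at this
    rw [this, one_mul]

def hG (d : ℕ) : Measure (Gd d) := Measure.haarMeasure ⊤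

instance (d : ℕ) : IsProbabilityMeasure (hG d) := ⟨by
  have := Measure.haarMeasure_self (K₀ := (⊤ : TopologicalSpace.PositiveCompacts (Gd d)))
  simpa [hG] using this⟩

instance (d : ℕ) : (hG d).IsMulLeftInvariant := by unfold hG; infer_instance

def act (g : Gd d) (x : Euc d) : Euc d := ((g⁻¹ : Gd d) : Euc d →L[ℝ] Euc d) x

lemma act_eq (g : Gd d) (x : Euc d) : act g x = Unitary.linearIsometryEquiv (g⁻¹) x := rfl

lemma norm_act (g : Gd d) (x : Euc d) : ‖act g x‖ = ‖x‖ := by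
  rw [act_eq]; exact LinearIsometryEquiv.norm_map _ _

lemma act_zero (g : Gd d) : act g 0 = 0 := by simp [act]
lemma act_smul (g : Gd d) (t : ℝ) (x : Euc d) : act g (t • x) = t • act g x := by simp [act]

lemma continuous_act : Continuous (fun p : Gd d × Euc d => act p.1 p.2) := by
  unfold act
  have h1 : Continuous (fun p : Gd d × Euc d => ((p.1⁻¹ : Gd d) : Euc d →L[ℝ] Euc d)) :=
    continuous_subtype_val.comp (continuous_inv.comp continuous_fst)
  exact h1.clm_apply continuous_snd

lemma cont_act {X : Type*} [TopologicalSpace X] {f : X → Gd d} {h : X → Euc d}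
    (hf : Continuous f) (hh : Continuous h) : Continuous (fun x => act (f x) (h x)) := by
  have := (continuous_act (d := d)).comp (hf.prodMk hh)
  exact this

lemma cont_w_act {X : Type*} [TopologicalSpace X] {f : X → Gd d} {h : X → Euc d} {w : Euc d → ℝ}
    (hw : Continuous w) (c : Euc d)
    (hf : Continuous f) (hh : Continuous h) : Continuous (fun x => w (c + act (f x) (h x))) :=
  hw.comp (continuous_const.add (cont_act hf hh))

lemma act_mul (g h : Gd d) (x : Euc d) : act (h * g) x = act g (act h x) := by
  simp [act, mul_inv_rev]

lemma exists_act (x y : Euc d) (h : ‖x‖ = ‖y‖) : ∃ g : Gd d, act g x = y := by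
  refine ⟨(Unitary.linearIsometryEquiv.symm (Submodule.reflection (ℝ ∙ (x - y))ᗮ))⁻¹, ?_⟩
  rw [act_eq, inv_inv, MulEquiv.apply_symm_apply]
  exact Submodule.reflection_sub h

lemma mp_act (g : Gd d) : MeasurePreserving (act g) (volume : Measure (Euc d)) volume :=
  LinearIsometryEquiv.measurePreserving (Unitary.linearIsometryEquiv (g⁻¹))

def RSym (w : Euc d → ℝ) (c x : Euc d) : ℝ := ∫ g, w (c + act g x) ∂(hG d)

lemma RSym_zero (w : Euc d → ℝ) (c : Euc d) : RSym w c 0 = w c := by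
  simp [RSym, act_zero]

lemma RSym_continuous (w : Euc d → ℝ) (hw : Continuous w) (M : ℝ) (hM : ∀ x, |w x| ≤ M) (c : Euc d) :
    Continuous (RSym w c) := by
  unfold RSym
  apply continuous_of_dominated (bound := fun _ => M)
  · intro x
    have : Continuous (fun g : Gd d => w (c + act g x)) :=
      cont_w_act hw c continuous_id continuous_const
    exact this.aestronglyMeasurable
  · intro x; exact Eventually.of_forall fun g => hM _
  · exact integrable_const _
  · refine Eventually.of_forall fun g => ?_
    exact cont_w_act hw c continuous_const continuous_id

lemma RSym_abs (w : Euc d → ℝ) (M : ℝ) (hM : ∀ x, |w x| ≤ M) (c x : Euc d) :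
    |RSym w c x| ≤ M := by
  have := norm_integral_le_of_norm_le_const (μ := hG d) (f := fun g => w (c + act g x)) (C := M)
    (Eventually.of_forall fun g => hM _)
  simpa [RSym] using this

lemma RSym_radial (w : Euc d → ℝ) (c x y : Euc d) (h : ‖x‖ = ‖y‖) : RSym w c x = RSym w c y := by
  obtain ⟨h0, rfl⟩ := exists_act x y h
  unfold RSym
  simp_rw [← act_mul]
  exact (integral_mul_left_eq_self (μ := hG d) (fun g => w (c + act g x)) h0).symm

lemma RSym_integral (w : Euc d → ℝ) (hw : Continuous w) (M : ℝ) (hM : ∀ x, |w x| ≤ M) (c : Euc d)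
    (k : Euc d → ℝ) (hk : Integrable k) (hinv : ∀ (g : Gd d) x, k (act g x) = k x) :
    ∫ x, RSym w c x * k x = ∫ x, w (c + x) * k x := by
  unfold RSym
  have hint : Integrable (Function.uncurry fun (x : Euc d) (g : Gd d) => w (c + act g x) * k x)
      ((volume : Measure (Euc d)).prod (hG d)) := by
    have h1 : Integrable (fun p : Euc d × Gd d => k p.1) ((volume : Measure (Euc d)).prod (hG d)) :=
      hk.comp_fst (hG d)
    refine h1.bdd_mul (c := M) (f := fun p : Euc d × Gd d => w (c + act p.2 p.1)) ?_ (Eventually.of_forall fun p => hM _)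
    have : Continuous (fun p : Euc d × Gd d => w (c + act p.2 p.1)) :=
      cont_w_act hw c continuous_snd continuous_fst
    exact this.aestronglyMeasurable
  calc ∫ x, (∫ g, w (c + act g x) ∂(hG d)) * k x
      = ∫ x, ∫ g, w (c + act g x) * k x ∂(hG d) := by
        congr 1; ext x; rw [integral_mul_const]
    _ = ∫ g, (∫ x, w (c + act g x) * k x) ∂(hG d) := integral_integral_swap hint
    _ = ∫ g : Gd d, (∫ x, w (c + x) * k x) ∂(hG d) := by
        congr 1; ext g
        have := (mp_act g).integral_comp
          ((Unitary.linearIsometryEquiv (g⁻¹)).toHomeomorph.measurableEmbedding) (fun x => w (c + x) * k x)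
        simp only [hinv] at this
        exact this
    _ = _ := by simp

lemma perp_fin (hd : 0 < d) (v : Euc d) (hv : v ≠ 0) :
    ((Module.finrank ℝ (ℝ ∙ v)ᗮ : ℕ) : ℝ) = (d : ℝ) - 1 := by
  obtain ⟨n, rfl⟩ : ∃ n, d = n + 1 := ⟨d - 1, by omega⟩
  haveI : Fact (Module.finrank ℝ (Euc (n+1)) = n + 1) := ⟨by simp⟩
  rw [Submodule.finrank_orthogonal_span_singleton (n := n) hv]
  push_cast; ring

lemma exists_norm (hd : 0 < d) (ρ : ℝ) (hρ : 0 ≤ ρ) : ∃ v : Euc d, ‖v‖ = ρ := by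
  refine ⟨EuclideanSpace.single ⟨0, hd⟩ ρ, ?_⟩
  simp [abs_of_nonneg hρ]

lemma sphere_pos (hd : 0 < d) (c : Euc d) (ρ : ℝ) (hρ : 0 < ρ) :
    0 < (μH[(d : ℝ) - 1] : Measure (Euc d)) (sphere c ρ) := by
  obtain ⟨v, hv⟩ := exists_norm hd ρ hρ.le
  have hv0 : v ≠ 0 := by rintro rfl; simp at hv; linarith
  have hf := perp_fin hd v hv0
  have hd1 : (0 : ℝ) ≤ (d : ℝ) - 1 := by rw [← hf]; positivity
  have hL : LipschitzWith 1 (fun y : Euc d => (ℝ ∙ v)ᗮ.orthogonalProjectionOnto (y - c)) := by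
    have h1 := (ℝ ∙ v)ᗮ.lipschitzWith_orthogonalProjectionOnto
    refine LipschitzWith.of_dist_le_mul fun a b => ?_
    have := h1.dist_le_mul (a - c) (b - c)
    simpa using this
  have h2 := hL.hausdorffMeasure_image_le hd1 (sphere c ρ)
  have h3 : ball (0 : (ℝ ∙ v)ᗮ) ρ ⊆
      (fun y : Euc d => (ℝ ∙ v)ᗮ.orthogonalProjectionOnto (y - c)) '' sphere c ρ := by
    intro q hq
    have hq' : ‖q‖ < ρ := by simpa using hq
    have hqv : ⟪(q : Euc d), v⟫ = 0 := by
      have := q.2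
      rw [Submodule.mem_orthogonal_singleton_iff_inner_left] at this
      exact this
    refine ⟨c + ((q : Euc d) + (Real.sqrt (ρ^2 - ‖q‖^2) / ρ) • v), ?_, ?_⟩
    · rw [mem_sphere_iff_norm, add_sub_cancel_left]
      have h4 : ‖(q : Euc d) + (Real.sqrt (ρ^2 - ‖q‖^2) / ρ) • v‖ ^ 2 = ρ ^ 2 := by
        rw [norm_add_sq_real, inner_smul_right, hqv, norm_smul, hv, Submodule.coe_norm]
        rw [Real.norm_of_nonneg (by positivity), div_mul_cancel₀ _ hρ.ne', Real.sq_sqrt]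
        · ring
        · have : ‖(q : Euc d)‖ < ρ := hq'
          have := norm_nonneg (q : Euc d)
          nlinarith
      exact (sq_eq_sq₀ (norm_nonneg _) hρ.le).1 h4
    · simp only [add_sub_cancel_left, map_add, map_smul]
      rw [Submodule.orthogonalProjectionOnto_mem_subspace_eq_self]
      rw [(Submodule.orthogonalProjectionOnto_eq_zero_iff (K := (ℝ ∙ v)ᗮ)).2]
      · simp
      · rw [Submodule.orthogonal_orthogonal]; exact Submodule.mem_span_singleton_self v
  have h4 : 0 < (μH[(d : ℝ) - 1] : Measure (ℝ ∙ v)ᗮ) (ball 0 ρ) := by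
    rw [← hf]
    exact isOpen_ball.measure_pos _ ⟨0, by simpa using hρ⟩
  have h5 := h4.trans_le ((measure_mono h3).trans h2)
  simpa using h5

lemma sphere_fin (hd : 0 < d) (c : Euc d) (ρ : ℝ) (hρ : 0 < ρ) :
    (μH[(d : ℝ) - 1] : Measure (Euc d)) (sphere c ρ) < ∞ := by
  apply (isCompact_sphere c ρ).measure_lt_top_of_nhdsWithin
  intro x hx
  set v := x - c with hvdef
  have hv : ‖v‖ = ρ := by simpa [mem_sphere_iff_norm] using hx
  have hv0 : v ≠ 0 := by intro h; rw [h] at hv; simp at hv; linarith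
  have hf := perp_fin hd v hv0
  have hd1 : (0 : ℝ) ≤ (d : ℝ) - 1 := by rw [← hf]; positivity
  let F : (ℝ ∙ v)ᗮ → Euc d := fun q => c + (ρ / ‖v + (q : Euc d)‖) • (v + (q : Euc d))
  have hne : ∀ q : (ℝ ∙ v)ᗮ, v + (q : Euc d) ≠ 0 := by
    intro q h
    have hq := q.2
    rw [Submodule.mem_orthogonal_singleton_iff_inner_right] at hq
    have : ⟪v, v + (q : Euc d)⟫ = 0 := by rw [h]; simp
    rw [inner_add_right, hq, add_zero, inner_self_eq_zero] at this
    exact hv0 this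
  have hF : ContDiff ℝ 1 F := by
    have h1 : ContDiff ℝ 1 (fun q : (ℝ ∙ v)ᗮ => v + (q : Euc d)) :=
      contDiff_const.add ((ℝ ∙ v)ᗮ.subtypeL.contDiff)
    have h2 : ContDiff ℝ 1 (fun q : (ℝ ∙ v)ᗮ => ‖v + (q : Euc d)‖) := h1.norm ℝ hne
    exact contDiff_const.add ((contDiff_const.div h2 (fun q => norm_ne_zero_iff.2 (hne q))).smul h1)
  obtain ⟨K, hK⟩ := (hF.locallyLipschitz.locallyLipschitzOn
    (s := closedBall (0 : (ℝ ∙ v)ᗮ) (3*ρ))).exists_lipschitzOnWith_of_compact (isCompact_closedBall _ _)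
  have h2 := hK.hausdorffMeasure_image_le hd1
  have h3 : (μH[(d : ℝ) - 1] : Measure (ℝ ∙ v)ᗮ) (closedBall 0 (3*ρ)) < ∞ := by
    rw [← hf]
    exact (isCompact_closedBall _ _).measure_lt_top
  have h4 : (μH[(d : ℝ) - 1] : Measure (Euc d)) (F '' closedBall 0 (3*ρ)) < ∞ := by
    refine h2.trans_lt (ENNReal.mul_lt_top ?_ h3)
    exact ENNReal.rpow_lt_top_of_nonneg hd1 ENNReal.coe_ne_top
  refine ⟨F '' closedBall 0 (3*ρ), ?_, h4⟩
  have hU : IsOpen {y : Euc d | ρ^2/2 < ⟪y - c, v⟫} :=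
    isOpen_lt continuous_const ((continuous_id.sub continuous_const).inner continuous_const)
  have hxU : x ∈ {y : Euc d | ρ^2/2 < ⟪y - c, v⟫} := by
    simp only [mem_setOf_eq, ← hvdef, real_inner_self_eq_norm_sq, hv]
    nlinarith
  refine mem_of_superset (inter_mem_nhdsWithin _ (hU.mem_nhds hxU)) ?_
  rintro y ⟨hyS, hyU⟩
  have hy : ‖y - c‖ = ρ := by simpa [mem_sphere_iff_norm] using hyS
  simp only [mem_setOf_eq] at hyU
  set I := ⟪y - c, v⟫ with hI
  have hIp : 0 < I := by nlinarith [sq_nonneg ρ]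
  have hqm : (ρ^2 / I) • (y - c) - v ∈ (ℝ ∙ v)ᗮ := by
    rw [Submodule.mem_orthogonal_singleton_iff_inner_left, inner_sub_left, inner_smul_left,
      real_inner_self_eq_norm_sq, hv, ← hI]
    simp only [conj_trivial]
    field_simp
    ring
  have ht : ρ^2 / I ≤ 2 := by rw [div_le_iff₀ hIp]; linarith
  have ht0 : 0 < ρ^2 / I := by positivity
  refine ⟨⟨_, hqm⟩, ?_, ?_⟩
  · rw [mem_closedBall_zero_iff, Submodule.coe_norm]
    refine (norm_sub_le _ _).trans ?_
    rw [norm_smul, Real.norm_of_nonneg ht0.le, hy, hv]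
    nlinarith
  · simp only [F, add_sub_cancel]
    rw [norm_smul, Real.norm_of_nonneg ht0.le, hy, smul_smul]
    have : ρ / (ρ ^ 2 / I * ρ) * (ρ ^ 2 / I) = 1 := by field_simp
    rw [this, one_smul, add_sub_cancel]

lemma sphere_map (hd : 0 < d) (c x : Euc d) (hx : x ≠ 0) :
    ((μH[(d : ℝ) - 1] : Measure (Euc d)) (sphere c ‖x‖))⁻¹ •
      (μH[(d : ℝ) - 1] : Measure (Euc d)).restrict (sphere c ‖x‖)
    = (hG d).map (fun g => c + act g x) := by
  have hρ : 0 < ‖x‖ := norm_pos_iff.2 hx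
  have hpos := sphere_pos hd c ‖x‖ hρ
  have hfin := sphere_fin hd c ‖x‖ hρ
  set σ := (μH[(d : ℝ) - 1] : Measure (Euc d)) with hσ
  set S := sphere c ‖x‖ with hS
  haveI : IsFiniteMeasure (σ.restrict S) := ⟨by simpa using hfin⟩
  have hca : Continuous (fun g : Gd d => c + act g x) :=
    continuous_const.add (cont_act continuous_id continuous_const)
  haveI : IsFiniteMeasure ((σ S)⁻¹ • σ.restrict S) :=
    Measure.smul_finite _ (ENNReal.inv_ne_top.2 hpos.ne')
  haveI : IsFiniteMeasure ((hG d).map (fun g => c + act g x)) :=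
    Measure.isFiniteMeasure_map _ _
  apply ext_of_forall_integral_eq_of_IsFiniteMeasure
  intro f
  rw [integral_map hca.aemeasurable f.continuous.aestronglyMeasurable, integral_smul_measure]
  have key : ∀ g : Gd d, ∫ y in S, f (c + act g (y - c)) ∂σ = ∫ y in S, f y ∂σ := by
    intro g
    let T : Euc d ≃ᵢ Euc d := ((IsometryEquiv.subRight c).trans
      ((Unitary.linearIsometryEquiv (g⁻¹)).toIsometryEquiv)).trans (IsometryEquiv.addLeft c)
    have hT : ∀ y, T y = c + act g (y - c) := fun y => rfl
    have hpre : T ⁻¹' S = S := by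
      ext y
      simp only [mem_preimage, hS, mem_sphere_iff_norm, hT, add_sub_cancel_left, norm_act]
    have hm := (T.measurePreserving_hausdorffMeasure ((d:ℝ)-1)).restrict_preimage
      (s := S) isClosed_sphere.measurableSet
    rw [hpre] at hm
    have := hm.integral_comp T.toHomeomorph.measurableEmbedding f
    exact this
  have hint : Integrable (Function.uncurry fun (y : Euc d) (g : Gd d) => f (c + act g (y - c)))
      ((σ.restrict S).prod (hG d)) := by
    refine Integrable.of_bound (C := ‖f‖) ?_ (Eventually.of_forall fun p => f.norm_coe_le_norm _)
    have : Continuous (Function.uncurry fun (y : Euc d) (g : Gd d) => f (c + act g (y - c))) :=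
      cont_w_act f.continuous c continuous_snd (continuous_fst.sub continuous_const)
    exact this.aestronglyMeasurable
  have h1 : ∫ y in S, f y ∂σ = ∫ g, (∫ y in S, f (c + act g (y - c)) ∂σ) ∂(hG d) := by
    simp [key]
  have h2 : ∫ y in S, f y ∂σ = ∫ y in S, RSym f c (y - c) ∂σ := by
    rw [h1, ← integral_integral_swap hint]; rfl
  have h3 : ∫ y in S, RSym f c (y - c) ∂σ = ∫ y in S, RSym f c x ∂σ := by
    apply setIntegral_congr_fun isClosed_sphere.measurableSet
    intro y hy
    exact RSym_radial _ _ _ _ (by simpa [hS, mem_sphere_iff_norm] using hy)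
  rw [h2, h3]
  simp only [integral_const, smul_eq_mul, MeasurableSet.univ, measureReal_restrict_apply, univ_inter]
  rw [ENNReal.toReal_inv, measureReal_def, ← mul_assoc, inv_mul_cancel₀, one_mul]
  · rfl
  · exact (ENNReal.toReal_pos hpos.ne' hfin.ne).ne'

lemma sphAvg_eq_map (hd : 0 < d) (u : Euc d → ℝ) (c x : Euc d) (hx : x ≠ 0) :
    sphAvg u c ‖x‖ = ∫ y, u y ∂((hG d).map (fun g => c + act g x)) := by
  rw [← sphere_map hd c x hx, integral_smul_measure]
  unfold sphAvg
  rw [ENNReal.toReal_inv, smul_eq_mul, div_eq_inv_mul]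

lemma sphAvg_eq_RSym (hd : 0 < d) (u : Euc d → ℝ) (c x : Euc d) (hx : x ≠ 0)
    (hu : AEStronglyMeasurable u ((μH[(d : ℝ) - 1] : Measure (Euc d)).restrict (sphere c ‖x‖))) :
    sphAvg u c ‖x‖ = RSym u c x := by
  rw [sphAvg_eq_map hd u c x hx, integral_map]
  · rfl
  · exact (continuous_const.add (cont_act continuous_id continuous_const)).aemeasurable
  · rw [← sphere_map hd c x hx]; exact hu.smul_measure _

def St (δ t : ℝ) : ℝ := Real.smoothTransition (t / δ)
def Th (δ t : ℝ) : ℝ := ∫ τ in (0:ℝ)..t, St δ τ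

lemma St_contDiff (δ : ℝ) : ContDiff ℝ (⊤ : ℕ∞) (St δ) :=
  Real.smoothTransition.contDiff.comp (contDiff_id.div_const δ)

lemma St_cont (δ : ℝ) : Continuous (St δ) := (St_contDiff δ).continuous

lemma St_nonneg (δ t : ℝ) : 0 ≤ St δ t := Real.smoothTransition.nonneg _
lemma St_le_one (δ t : ℝ) : St δ t ≤ 1 := Real.smoothTransition.le_one _

lemma St_zero {δ t : ℝ} (hδ : 0 < δ) (ht : t ≤ 0) : St δ t = 0 :=
  Real.smoothTransition.zero_of_nonpos (div_nonpos_of_nonpos_of_nonneg ht hδ.le)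

lemma St_one {δ t : ℝ} (hδ : 0 < δ) (ht : δ ≤ t) : St δ t = 1 :=
  Real.smoothTransition.one_of_one_le ((one_le_div hδ).2 ht)

lemma St_hasDeriv (δ t : ℝ) : HasDerivAt (St δ) (deriv (St δ) t) t :=
  ((St_contDiff δ).differentiable (by simp) t).hasDerivAt

lemma dSt_cont (δ : ℝ) : Continuous (deriv (St δ)) :=
  (St_contDiff δ).continuous_deriv (by simp)

lemma dSt_nonneg {δ : ℝ} (hδ : 0 < δ) (t : ℝ) : 0 ≤ deriv (St δ) t := by
  have : Monotone (St δ) := fun a b h => Real.smoothTransition.monotone (by gcongr)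
  exact this.deriv_nonneg

lemma dSt_supp {δ t : ℝ} (hδ : 0 < δ) (h : deriv (St δ) t ≠ 0) : 0 ≤ t ∧ t ≤ δ := by
  constructor
  · by_contra! ht
    apply h
    have : St δ =ᶠ[𝓝 t] fun _ => 0 := by
      filter_upwards [Iio_mem_nhds ht] with s hs using St_zero hδ (le_of_lt hs)
    rw [this.deriv_eq]; simp
  · by_contra! ht
    apply h
    have : St δ =ᶠ[𝓝 t] fun _ => 1 := by
      filter_upwards [Ioi_mem_nhds ht] with s hs using St_one hδ (le_of_lt hs)
    rw [this.deriv_eq]; simp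

lemma Th_hasDeriv (δ t : ℝ) : HasDerivAt (Th δ) (St δ t) t :=
  intervalIntegral.integral_hasDerivAt_right ((St_cont δ).intervalIntegrable _ _)
    ((St_cont δ).stronglyMeasurableAtFilter _ _) (St_cont δ).continuousAt

lemma Th_contDiff (δ : ℝ) : ContDiff ℝ (⊤ : ℕ∞) (Th δ) := by
  rw [contDiff_infty_iff_deriv]
  refine ⟨fun t => (Th_hasDeriv δ t).differentiableAt, ?_⟩
  have : deriv (Th δ) = St δ := by ext t; exact (Th_hasDeriv δ t).deriv
  rw [this]; exact St_contDiff δ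

lemma Th_zero {δ t : ℝ} (hδ : 0 < δ) (ht : t ≤ 0) : Th δ t = 0 := by
  unfold Th
  rw [intervalIntegral.integral_congr (g := fun _ => (0:ℝ))]
  · simp
  · intro s hs
    rw [uIcc_of_ge ht] at hs
    exact St_zero hδ hs.2

lemma Th_nonneg {δ : ℝ} (hδ : 0 < δ) (t : ℝ) : 0 ≤ Th δ t := by
  rcases le_total t 0 with h | h
  · rw [Th_zero hδ h]
  · exact intervalIntegral.integral_nonneg h fun s _ => St_nonneg _ _

def qf (c : Euc d) (ρ : ℝ) (x : Euc d) : ℝ := ρ ^ 2 - ‖x - c‖ ^ 2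
def ph (c : Euc d) (ρ δ : ℝ) (x : Euc d) : ℝ := Th δ (qf c ρ x)
def Ph (c : Euc d) (ρ δ : ℝ) (x : Euc d) : Euc d := (-2 * St δ (qf c ρ x)) • (x - c)
def Lf (c : Euc d) (ρ δ : ℝ) (x : Euc d) : ℝ :=
  4 * ‖x - c‖ ^ 2 * deriv (St δ) (qf c ρ x) - 2 * d * St δ (qf c ρ x)

lemma qf_contDiff (c : Euc d) (ρ : ℝ) : ContDiff ℝ (⊤ : ℕ∞) (qf c ρ) :=
  contDiff_const.sub ((contDiff_id.sub contDiff_const).norm_sq ℝ)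

lemma qf_hasFDeriv (c : Euc d) (ρ : ℝ) (x : Euc d) :
    HasFDerivAt (qf c ρ) (-(2 • innerSL ℝ (x - c))) x := by
  have h := ((hasFDerivAt_id x).sub_const c).norm_sq
  have h2 := h.const_sub (ρ ^ 2)
  refine h2.congr_fderiv ?_
  ext v; simp

lemma qf_neg {c : Euc d} {ρ : ℝ} (hρ : 0 < ρ) {x : Euc d} (hx : x ∉ closedBall c ρ) : qf c ρ x ≤ 0 := by
  have : ρ < ‖x - c‖ := by simpa [mem_closedBall, dist_eq_norm] using hx
  unfold qf; nlinarith

lemma ph_contDiff (c : Euc d) (ρ δ : ℝ) : ContDiff ℝ (⊤ : ℕ∞) (ph c ρ δ) :=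
  (Th_contDiff δ).comp (qf_contDiff c ρ)

lemma ph_nonneg (c : Euc d) (ρ : ℝ) {δ : ℝ} (hδ : 0 < δ) (x : Euc d) : 0 ≤ ph c ρ δ x := Th_nonneg hδ _

lemma ph_supp (c : Euc d) {ρ δ : ℝ} (hρ : 0 < ρ) (hδ : 0 < δ) :
    tsupport (ph c ρ δ) ⊆ closedBall c ρ := by
  apply closure_minimal _ isClosed_closedBall
  intro x hx
  by_contra h
  exact hx (Th_zero hδ (qf_neg hρ h))

lemma ph_cs (c : Euc d) {ρ δ : ℝ} (hρ : 0 < ρ) (hδ : 0 < δ) : HasCompactSupport (ph c ρ δ) :=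
  (isCompact_closedBall c ρ).of_isClosed_subset (isClosed_tsupport _) (ph_supp c hρ hδ)

lemma ph_grad (c : Euc d) (ρ δ : ℝ) (x : Euc d) : gradient (ph c ρ δ) x = Ph c ρ δ x := by
  have h := (Th_hasDeriv δ (qf c ρ x)).comp_hasFDerivAt x (qf_hasFDeriv c ρ x)
  apply HasGradientAt.gradient
  rw [hasGradientAt_iff_hasFDerivAt]
  refine h.congr_fderiv ?_
  ext v
  simp [Ph, inner_smul_left]
  ring

lemma Ph_cont (c : Euc d) (ρ δ : ℝ) : Continuous (Ph c ρ δ) :=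
  (continuous_const.mul ((St_cont δ).comp (qf_contDiff c ρ).continuous)).smul
    (continuous_id.sub continuous_const)

lemma Ph_cs (c : Euc d) {ρ δ : ℝ} (hρ : 0 < ρ) (hδ : 0 < δ) : HasCompactSupport (Ph c ρ δ) := by
  apply HasCompactSupport.intro (isCompact_closedBall c ρ)
  intro x hx
  simp [Ph, St_zero hδ (qf_neg hρ hx)]

lemma Lf_zero (c : Euc d) {ρ δ : ℝ} (hρ : 0 < ρ) (hδ : 0 < δ) {x : Euc d} (hx : x ∉ closedBall c ρ) :
    Lf c ρ δ x = 0 := by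
  have h1 : qf c ρ x < 0 := by
    have : ρ < ‖x - c‖ := by simpa [mem_closedBall, dist_eq_norm] using hx
    unfold qf; nlinarith
  have h2 : deriv (St δ) (qf c ρ x) = 0 := by
    by_contra h
    exact absurd (dSt_supp hδ h).1 (by linarith)
  simp [Lf, h2, St_zero hδ h1.le]

lemma Lf_cont (c : Euc d) (ρ δ : ℝ) : Continuous (Lf c ρ δ) := by
  have hq := (qf_contDiff c ρ).continuous
  have h1 := (dSt_cont δ).comp hq
  have h2 := (St_cont δ).comp hq
  unfold Lf
  exact ((continuous_const.mul ((continuous_id.sub continuous_const).norm.pow 2)).mul h1).sub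
    (continuous_const.mul h2)

lemma Lf_cs (c : Euc d) {ρ δ : ℝ} (hρ : 0 < ρ) (hδ : 0 < δ) : HasCompactSupport (Lf c ρ δ) :=
  HasCompactSupport.intro (isCompact_closedBall c ρ) fun _ hx => Lf_zero c hρ hδ hx

lemma ibp (f g : Euc d → ℝ) (hf : ContDiff ℝ 1 f) (hg : ContDiff ℝ 1 g) (hc : HasCompactSupport g)
    (v : Euc d) : ∫ x, fderiv ℝ f x v * g x = - ∫ x, f x * fderiv ℝ g x v := by
  have hf' : Continuous (fun x => fderiv ℝ f x v) :=
    (hf.continuous_fderiv (by simp)).clm_apply continuous_const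
  have hg' : Continuous (fun x => fderiv ℝ g x v) :=
    (hg.continuous_fderiv (by simp)).clm_apply continuous_const
  have hgc : HasCompactSupport (fun x => fderiv ℝ g x v) := hc.fderiv_apply (𝕜 := ℝ) v
  have := integral_mul_fderiv_eq_neg_fderiv_mul_of_integrable (μ := (volume : Measure (Euc d)))
    (f := f) (g := g) (v := v) ?_ ?_ ?_ ?_ ?_
  · rw [this, neg_neg]
  · exact (hf'.mul hg.continuous).integrable_of_hasCompactSupport hc.mul_left
  · exact (hf.continuous.mul hg').integrable_of_hasCompactSupport hgc.mul_left
  · exact (hf.continuous.mul hg.continuous).integrable_of_hasCompactSupport hc.mul_left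
  · exact fun x _ => hf.differentiable (by simp) x
  · exact fun x _ => hg.differentiable (by simp) x

lemma Phi_comp_fderiv (c : Euc d) (ρ δ : ℝ) (i : Fin d) (x : Euc d) :
    fderiv ℝ (fun x => Ph c ρ δ x i) x (EuclideanSpace.single i 1) =
      4 * (x i - c i) ^ 2 * deriv (St δ) (qf c ρ x) - 2 * St δ (qf c ρ x) := by
  have h1 := ((St_hasDeriv δ (qf c ρ x)).comp_hasFDerivAt x (qf_hasFDeriv c ρ x)).const_mul (-2)
  have h2 : HasFDerivAt (fun x : Euc d => x i - c i) (EuclideanSpace.proj i : Euc d →L[ℝ] ℝ) x :=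
    (EuclideanSpace.proj i : Euc d →L[ℝ] ℝ).hasFDerivAt.sub_const _
  have h3 := h1.mul h2
  have h4 : HasFDerivAt (fun x => Ph c ρ δ x i) _ x := h3.congr_of_eventuallyEq
    (Eventually.of_forall fun y => by simp [Ph])
  rw [h4.fderiv]
  simp [EuclideanSpace.inner_single_right]
  ring

lemma Phi_comp_contDiff (c : Euc d) (ρ δ : ℝ) (i : Fin d) : ContDiff ℝ 1 (fun x => Ph c ρ δ x i) := by
  have h1 : ContDiff ℝ (⊤ : ℕ∞) (fun x => (-2 * St δ (qf c ρ x)) * (x i - c i)) :=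
    (contDiff_const.mul ((St_contDiff δ).comp (qf_contDiff c ρ))).mul
      ((EuclideanSpace.proj i : Euc d →L[ℝ] ℝ).contDiff.sub contDiff_const)
  have h2 : (fun x => Ph c ρ δ x i) = fun x => (-2 * St δ (qf c ρ x)) * (x i - c i) := by
    ext x; simp [Ph]
  rw [h2]; exact h1.of_le (by exact_mod_cast le_top)

lemma grad_inner (ψ : Euc d → ℝ) (x v : Euc d) :
    ⟪gradient ψ x, v⟫ = ∑ i, fderiv ℝ ψ x (EuclideanSpace.single i 1) * v i := by
  have h1 : ⟪gradient ψ x, v⟫ = fderiv ℝ ψ x v := by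
    unfold gradient; simp
  have h2 : v = ∑ i, v i • (EuclideanSpace.single i (1:ℝ) : Euc d) := by
    ext j; simp [Finset.sum_apply, Pi.single_apply]
  rw [h1]
  conv_lhs => rw [h2]
  rw [map_sum]
  refine Finset.sum_congr rfl fun i _ => ?_
  rw [map_smul, smul_eq_mul, mul_comm]

lemma L_sum (c : Euc d) (ρ δ : ℝ) (x : Euc d) :
    ∑ i, fderiv ℝ (fun x => Ph c ρ δ x i) x (EuclideanSpace.single i 1) = Lf c ρ δ x := by
  simp_rw [Phi_comp_fderiv]
  rw [Finset.sum_sub_distrib, ← Finset.sum_mul, ← Finset.mul_sum]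
  unfold Lf
  rw [EuclideanSpace.norm_sq_eq]
  simp
  ring

lemma ibp_L (c : Euc d) {ρ δ : ℝ} (hρ : 0 < ρ) (hδ : 0 < δ) (ψ : Euc d → ℝ) (hψ : ContDiff ℝ 1 ψ) :
    ∫ x, ⟪gradient ψ x, Ph c ρ δ x⟫ = - ∫ x, ψ x * Lf c ρ δ x := by
  have hcs : ∀ i, HasCompactSupport (fun x => Ph c ρ δ x i) := fun i =>
    (Ph_cs c hρ hδ).comp_left (g := fun y : Euc d => y i) rfl
  simp_rw [grad_inner, ← L_sum, Finset.mul_sum]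
  rw [integral_finsetSum, integral_finsetSum, ← Finset.sum_neg_distrib]
  · refine Finset.sum_congr rfl fun i _ => ?_
    exact ibp ψ _ hψ (Phi_comp_contDiff c ρ δ i) (hcs i) _
  · intro i _
    refine (hψ.continuous.mul (((Phi_comp_contDiff c ρ δ i).continuous_fderiv (by simp)).clm_apply
      continuous_const)).integrable_of_hasCompactSupport ?_
    exact ((hcs i).fderiv_apply (𝕜 := ℝ) _).mul_left
  · intro i _
    refine (((hψ.continuous_fderiv (by simp)).clm_apply
      continuous_const).mul (Phi_comp_contDiff c ρ δ i).continuous).integrable_of_hasCompactSupport ?_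
    exact (hcs i).mul_left

lemma int_L (c : Euc d) {ρ δ : ℝ} (hρ : 0 < ρ) (hδ : 0 < δ) : ∫ x, Lf c ρ δ x = 0 := by
  have h := ibp_L c hρ hδ (fun _ => 1) contDiff_const
  have h0 : ∀ x : Euc d, gradient (fun _ : Euc d => (1:ℝ)) x = 0 := by
    intro x; simp [gradient]
  simp only [h0, inner_zero_left, integral_zero, one_mul] at h
  linarith

lemma int_sq_L (c x₀ : Euc d) {ρ δ : ℝ} (hρ : 0 < ρ) (hδ : 0 < δ) :
    ∫ x, ‖x - x₀‖ ^ 2 * Lf c ρ δ x = 2 * d * ∫ x, ph c ρ δ x := by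
  have hc : ContDiff ℝ 1 (fun x : Euc d => ‖x - x₀‖ ^ 2) := (contDiff_id.sub contDiff_const).norm_sq ℝ
  have h := ibp_L c hρ hδ _ hc
  have hph : ContDiff ℝ 1 (ph c ρ δ) := (ph_contDiff c ρ δ).of_le (by exact_mod_cast le_top)
  have hg : ∀ x : Euc d, gradient (fun x : Euc d => ‖x - x₀‖ ^ 2) x = (2:ℝ) • (x - x₀) := by
    intro x
    apply HasGradientAt.gradient
    rw [hasGradientAt_iff_hasFDerivAt]
    refine (((hasFDerivAt_id x).sub_const x₀).norm_sq).congr_fderiv ?_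
    ext v; simp [inner_smul_left]
  have e1 : ∀ x : Euc d, ⟪gradient (fun x : Euc d => ‖x - x₀‖ ^ 2) x, Ph c ρ δ x⟫
      = ∑ i, (2 * (x i - x₀ i)) * fderiv ℝ (ph c ρ δ) x (EuclideanSpace.single i 1) := by
    intro x
    rw [hg, ← ph_grad, real_inner_comm, grad_inner]
    refine Finset.sum_congr rfl fun i _ => ?_
    simp; ring
  have hlin : ∀ i : Fin d, ContDiff ℝ 1 (fun x : Euc d => 2 * (x i - x₀ i)) := fun i =>
    contDiff_const.mul ((EuclideanSpace.proj i : Euc d →L[ℝ] ℝ).contDiff.sub contDiff_const)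
  have hlin' : ∀ (i : Fin d) (x : Euc d),
      fderiv ℝ (fun x : Euc d => 2 * (x i - x₀ i)) x (EuclideanSpace.single i 1) = 2 := by
    intro i x
    have h2 : HasFDerivAt (fun x : Euc d => 2 * (x i - x₀ i)) _ x :=
      ((EuclideanSpace.proj i : Euc d →L[ℝ] ℝ).hasFDerivAt.sub_const _).const_mul 2
    rw [h2.fderiv]; simp
  simp_rw [e1] at h
  rw [integral_finsetSum] at h
  · have h3 : ∀ i : Fin d, ∫ x, (2 * (x i - x₀ i)) * fderiv ℝ (ph c ρ δ) x (EuclideanSpace.single i 1)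
        = - (2 * ∫ x, ph c ρ δ x) := by
      intro i
      have := ibp _ (ph c ρ δ) (hlin i) hph (ph_cs c hρ hδ) (EuclideanSpace.single i 1)
      simp_rw [hlin'] at this
      rw [integral_const_mul] at this
      rw [this, neg_neg]
    simp_rw [h3] at h
    simp at h
    linarith
  · intro i _
    refine ((hlin i).continuous.mul ((hph.continuous_fderiv (by simp)).clm_apply
      continuous_const)).integrable_of_hasCompactSupport ?_
    exact ((ph_cs c hρ hδ).fderiv_apply (𝕜 := ℝ) _).mul_left

lemma grad_cont {ψ : Euc d → ℝ} (h : ContDiff ℝ 1 ψ) : Continuous (fun x => gradient ψ x) :=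
  (InnerProductSpace.toDual ℝ (Euc d)).symm.continuous.comp (h.continuous_fderiv (by simp))

lemma grad_cs {ψ : Euc d → ℝ} (h : HasCompactSupport ψ) : HasCompactSupport (fun x => gradient ψ x) :=
  (h.fderiv (𝕜 := ℝ)).comp_left (g := (InnerProductSpace.toDual ℝ (Euc d)).symm) (map_zero _)

lemma weak_ibp (D : Set (Euc d)) (u : Euc d → ℝ) (hu : MemH10 D u) (c : Euc d) {ρ δ : ℝ}
    (hρ : 0 < ρ) (hδ : 0 < δ) :
    ∫ x, ⟪gradient u x, Ph c ρ δ x⟫ = - ∫ x, u x * Lf c ρ δ x := by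
  obtain ⟨hu2, hg2, ψ, hψ, hlim⟩ := hu
  have hL2 : MemLp (Lf c ρ δ) 2 volume := (Lf_cont c ρ δ).memLp_of_hasCompactSupport (Lf_cs c hρ hδ)
  have hP2 : MemLp (Ph c ρ δ) 2 volume := (Ph_cont c ρ δ).memLp_of_hasCompactSupport (Ph_cs c hρ hδ)
  have hψ1 : ∀ n, ContDiff ℝ 1 (ψ n) := fun n => (hψ n).1.of_le (by exact_mod_cast le_top)
  have hψ2 : ∀ n, MemLp (ψ n) 2 volume := fun n =>
    (hψ1 n).continuous.memLp_of_hasCompactSupport (hψ n).2.1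
  have hψg : ∀ n, MemLp (fun x => gradient (ψ n) x) 2 volume := fun n =>
    (grad_cont (hψ1 n)).memLp_of_hasCompactSupport (grad_cs (hψ n).2.1)
  have iuL : Integrable (fun x => u x * Lf c ρ δ x) := hu2.integrable_mul hL2
  have iψL : ∀ n, Integrable (fun x => ψ n x * Lf c ρ δ x) := fun n => (hψ2 n).integrable_mul hL2
  have inn : ∀ {F : Euc d → Euc d}, MemLp F 2 volume → Integrable (fun x => ⟪F x, Ph c ρ δ x⟫) :=
    fun hF => by
      have hn := hF.norm.integrable_mul hP2.norm
      refine hn.mono (hF.1.inner hP2.1) (Eventually.of_forall fun x => ?_)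
      simpa using norm_inner_le_norm (𝕜 := ℝ) _ _
  set T : ℝ := ∫ x, (u x * Lf c ρ δ x + ⟪gradient u x, Ph c ρ δ x⟫) with hT
  suffices T = 0 by
    rw [hT, integral_add iuL (inn hg2)] at this
    linarith
  set B : ℝ := ∫ x, ((Lf c ρ δ x) ^ 2 + ‖Ph c ρ δ x‖ ^ 2) with hB
  have iB : Integrable (fun x => (Lf c ρ δ x) ^ 2 + ‖Ph c ρ δ x‖ ^ 2) :=
    hL2.integrable_sq.add hP2.norm.integrable_sq
  have hTn : ∀ n, T = ∫ x, ((u x - ψ n x) * Lf c ρ δ x + ⟪gradient u x - gradient (ψ n) x, Ph c ρ δ x⟫) := by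
    intro n
    have h1 := ibp_L c hρ hδ (ψ n) (hψ1 n)
    have h2 : ∫ x, (ψ n x * Lf c ρ δ x + ⟪gradient (ψ n) x, Ph c ρ δ x⟫) = 0 := by
      rw [integral_add (iψL n) (inn (hψg n)), h1]; ring
    have h3 := integral_sub (iuL.add (inn hg2)) ((iψL n).add (inn (hψg n)))
    simp only [Pi.add_apply] at h3
    rw [h2, sub_zero] at h3
    rw [hT, ← h3]
    congr 1; ext x; rw [inner_sub_left]; ring
  have hbound : ∀ (t : ℝ), 0 < t → ∀ n, |T| ≤ (2 * t)⁻¹ * (∫ x, ((u x - ψ n x) ^ 2 + ‖gradient u x - gradient (ψ n) x‖ ^ 2))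
      + t / 2 * B := by
    intro t ht n
    have ia : Integrable (fun x => (u x - ψ n x) ^ 2 + ‖gradient u x - gradient (ψ n) x‖ ^ 2) :=
      (hu2.sub (hψ2 n)).integrable_sq.add (hg2.sub (hψg n)).norm.integrable_sq
    rw [hTn n, hB, ← integral_const_mul, ← integral_const_mul, ← integral_add (ia.const_mul _) (iB.const_mul _)]
    refine (abs_integral_le_integral_abs).trans ?_
    refine integral_mono_of_nonneg (Eventually.of_forall fun x => abs_nonneg _)
      ((ia.const_mul _).add (iB.const_mul _)) (Eventually.of_forall fun x => ?_)
    simp only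
    have key : ∀ a b : ℝ, a * b ≤ (2 * t)⁻¹ * a ^ 2 + t / 2 * b ^ 2 := by
      intro a b
      have : (2 * t)⁻¹ * a ^ 2 + t / 2 * b ^ 2 - a * b = (2 * t)⁻¹ * (a - t * b) ^ 2 := by
        field_simp; ring
      have h4 : 0 ≤ (2 * t)⁻¹ * (a - t * b) ^ 2 := by positivity
      linarith
    have k1 := key |u x - ψ n x| |Lf c ρ δ x|
    have k2 := key ‖gradient u x - gradient (ψ n) x‖ ‖Ph c ρ δ x‖
    have k3 := norm_inner_le_norm (𝕜 := ℝ) (gradient u x - gradient (ψ n) x) (Ph c ρ δ x)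
    rw [Real.norm_eq_abs] at k3
    have k4 := abs_add_le ((u x - ψ n x) * Lf c ρ δ x) (⟪gradient u x - gradient (ψ n) x, Ph c ρ δ x⟫)
    rw [abs_mul] at k4
    rw [sq_abs, sq_abs] at k1
    linarith
  have hb2 : ∀ t : ℝ, 0 < t → |T| ≤ t / 2 * B := by
    intro t ht
    have h1 := (hlim.const_mul (2 * t)⁻¹).add_const (t / 2 * B)
    simp only [mul_zero, zero_add] at h1
    exact ge_of_tendsto' h1 (hbound t ht)
  have h3 : Tendsto (fun t : ℝ => t / 2 * B) (𝓝[>] 0) (𝓝 0) := by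
    have : Continuous (fun t : ℝ => t / 2 * B) := by fun_prop
    have := this.tendsto 0
    simp only [zero_div, zero_mul] at this
    exact this.mono_left nhdsWithin_le_nhds
  have h4 : |T| ≤ 0 := ge_of_tendsto h3 (by
    filter_upwards [self_mem_nhdsWithin] with t ht using hb2 t ht)
  exact abs_eq_zero.1 (le_antisymm h4 (abs_nonneg _))

/-- weak subharmonicity of u + K/(2d) |x-x₀|² against the special test functions -/
lemma weak_sub (hd : 0 < d) (D : Set (Euc d)) (lama M : ℝ) (u : Euc d → ℝ) (hu : MemH10 D u)
    (hnn : ∀ x, 0 ≤ u x) (hM : ∀ x, u x ≤ M)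
    (hsub : ∀ φ : Euc d → ℝ, TestFun D φ → (∀ x, 0 ≤ φ x) →
      (∫ x, ⟪gradient u x, gradient φ x⟫) ≤ lama * ∫ x, u x * φ x)
    (c x₀ : Euc d) {ρ δ : ℝ} (hρ : 0 < ρ) (hδ : 0 < δ) (hD : closedBall c ρ ⊆ D) :
    0 ≤ ∫ x, (u x + (|lama| * M) / (2 * d) * ‖x - x₀‖ ^ 2) * Lf c ρ δ x := by
  have h1 := hsub (ph c ρ δ) ⟨ph_contDiff c ρ δ, ph_cs c hρ hδ, (ph_supp c hρ hδ).trans hD⟩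
    (ph_nonneg c ρ hδ)
  simp_rw [ph_grad] at h1
  rw [weak_ibp D u hu c hρ hδ] at h1
  have hL2 : MemLp (Lf c ρ δ) 2 volume := (Lf_cont c ρ δ).memLp_of_hasCompactSupport (Lf_cs c hρ hδ)
  have hp2 : MemLp (ph c ρ δ) 2 volume :=
    (ph_contDiff c ρ δ).continuous.memLp_of_hasCompactSupport (ph_cs c hρ hδ)
  have ip : Integrable (ph c ρ δ) volume :=
    (ph_contDiff c ρ δ).continuous.integrable_of_hasCompactSupport (ph_cs c hρ hδ)
  have h2 : ∫ x, u x * ph c ρ δ x ≤ M * ∫ x, ph c ρ δ x := by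
    rw [← integral_const_mul]
    refine integral_mono (hu.1.integrable_mul hp2) (ip.const_mul M) fun x => ?_
    exact mul_le_mul_of_nonneg_right (hM x) (ph_nonneg c ρ hδ x)
  have h3 : 0 ≤ ∫ x, u x * ph c ρ δ x :=
    integral_nonneg fun x => mul_nonneg (hnn x) (ph_nonneg c ρ hδ x)
  have h4 := int_sq_L c x₀ hρ hδ
  have h5 : ∫ x, (u x + (|lama| * M) / (2 * d) * ‖x - x₀‖ ^ 2) * Lf c ρ δ x
      = (∫ x, u x * Lf c ρ δ x) + (|lama| * M) / (2 * d) * ∫ x, ‖x - x₀‖ ^ 2 * Lf c ρ δ x := by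
    rw [← integral_const_mul, ← integral_add]
    · congr 1; ext x; ring
    · exact hu.1.integrable_mul hL2
    · refine Integrable.const_mul ?_ _
      exact (((continuous_id.sub continuous_const).norm.pow 2).mul
        (Lf_cont c ρ δ)).integrable_of_hasCompactSupport (Lf_cs c hρ hδ).mul_left
  have hd' : (0:ℝ) < d := by exact_mod_cast hd
  have h6 : (|lama| * M) / (2 * d) * (2 * d * ∫ x, ph c ρ δ x) = |lama| * (M * ∫ x, ph c ρ δ x) := by
    field_simp
  rw [h5, h4, h6]
  have h7 : lama * ∫ x, u x * ph c ρ δ x ≤ |lama| * (M * ∫ x, ph c ρ δ x) :=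
    (mul_le_mul_of_nonneg_right (le_abs_self _) h3).trans
      (mul_le_mul_of_nonneg_left h2 (abs_nonneg _))
  linarith

lemma core (hd : 0 < d) (w : Euc d → ℝ) (hw : Continuous w) (M : ℝ) (hM : ∀ x, |w x| ≤ M)
    (c x : Euc d) (hx : x ≠ 0) (hH : ∀ δ > 0, 0 ≤ ∫ z, w z * Lf c ‖x‖ δ z) :
    ∫ z in ball (0 : Euc d) ‖x‖, (RSym w c z - RSym w c x) ≤ 0 := by
  set W := RSym w c with hW
  set ρ := ‖x‖ with hρdef
  have hρ : 0 < ρ := norm_pos_iff.2 hx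
  have hWc : Continuous W := RSym_continuous w hw M hM c
  have hWM : ∀ z, |W z| ≤ M := RSym_abs w M hM c
  have hd' : (0:ℝ) < d := by exact_mod_cast hd
  -- centered kernel
  have hk0 : ∀ δ z, Lf c ρ δ (c + z) = Lf 0 ρ δ z := by intro δ z; simp [Lf, qf]
  have hLint : ∀ δ > 0, Integrable (Lf (0 : Euc d) ρ δ) := fun δ hδ =>
    (Lf_cont 0 ρ δ).integrable_of_hasCompactSupport (Lf_cs 0 hρ hδ)
  have hpos : ∀ δ > 0, 0 ≤ ∫ z, W z * Lf 0 ρ δ z := by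
    intro δ hδ
    rw [hW, RSym_integral w hw M hM c _ (hLint δ hδ) (by intro g z; simp [Lf, qf, norm_act])]
    have := hH δ hδ
    rw [← integral_add_left_eq_self _ c] at this
    simpa only [hk0] using this
  have main : ∀ ε > 0, ∫ z in ball (0 : Euc d) ρ, (W z - W x - ε) ≤ 0 := by
    intro ε hε
    have hcont : Continuous (fun t : ℝ => W (t • x)) := hWc.comp (continuous_id.smul continuous_const)
    obtain ⟨η, hη, hηW⟩ := Metric.continuous_iff.1 hcont 1 ε hε
    have shell : ∀ δ, 0 < δ → δ < η * ρ ^ 2 → ∀ z : Euc d, 0 ≤ qf 0 ρ z → qf 0 ρ z ≤ δ →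
        W z - W x - ε ≤ 0 := by
      intro δ hδ hδη z hz0 hz1
      simp only [qf, sub_zero] at hz0 hz1
      set t := ‖z‖ / ρ with ht
      have hzt : ‖z‖ = t * ρ := by rw [ht]; field_simp
      have ht0 : 0 ≤ t := by positivity
      rw [hzt] at hz0 hz1
      have hρ2 : 0 < ρ ^ 2 := by positivity
      have ht1 : t ^ 2 ≤ 1 := by
        by_contra! h; nlinarith
      have ht2 : 1 - t ^ 2 < η := by
        by_contra! h; nlinarith
      have ht3 : t ≤ 1 := by nlinarith
      have hd1 : dist t 1 < η := by
        rw [Real.dist_eq, abs_lt]; constructor <;> nlinarith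
      have h1 := hηW t hd1
      simp only [one_smul, Real.dist_eq] at h1
      have h2 : W z = W (t • x) := RSym_radial w c _ _ (by
        rw [norm_smul, Real.norm_of_nonneg ht0, ← hρdef, hzt])
      rw [h2]
      linarith [(abs_lt.1 h1).2]
    set V : Euc d → ℝ := fun z => W z - W x - ε with hV
    have hVc : Continuous V := (hWc.sub continuous_const).sub continuous_const
    have step : ∀ δ, 0 < δ → δ < η * ρ ^ 2 → ∫ z, V z * St δ (qf 0 ρ z) ≤ 0 := by
      intro δ hδ hδη
      have i1 : Integrable (fun z => W z * Lf 0 ρ δ z) :=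
        (hWc.mul (Lf_cont 0 ρ δ)).integrable_of_hasCompactSupport (Lf_cs 0 hρ hδ).mul_left
      have i2 : Integrable (fun z => V z * Lf 0 ρ δ z) :=
        (hVc.mul (Lf_cont 0 ρ δ)).integrable_of_hasCompactSupport (Lf_cs 0 hρ hδ).mul_left
      have hScs : HasCompactSupport (fun z : Euc d => St δ (qf 0 ρ z)) :=
        HasCompactSupport.intro (isCompact_closedBall 0 ρ) fun z hz => St_zero hδ (qf_neg hρ hz)
      have hSc : Continuous (fun z : Euc d => St δ (qf 0 ρ z)) :=
        (St_cont δ).comp (qf_contDiff 0 ρ).continuous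
      have i3 : Integrable (fun z => V z * St δ (qf 0 ρ z)) :=
        (hVc.mul hSc).integrable_of_hasCompactSupport hScs.mul_left
      have e1 : ∫ z, V z * Lf 0 ρ δ z = ∫ z, W z * Lf 0 ρ δ z := by
        have : ∀ z, V z * Lf 0 ρ δ z = W z * Lf 0 ρ δ z - (W x + ε) * Lf 0 ρ δ z := by
          intro z; simp only [hV]; ring
        simp_rw [this]
        rw [integral_sub i1 ((hLint δ hδ).const_mul _), integral_const_mul, int_L 0 hρ hδ]
        ring
      have h0 : 0 ≤ ∫ z, V z * Lf 0 ρ δ z := by rw [e1]; exact hpos δ hδ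
      have h1 : ∫ z, V z * Lf 0 ρ δ z ≤ ∫ z, (-(2 * d)) * (V z * St δ (qf 0 ρ z)) := by
        refine integral_mono i2 (i3.const_mul _) fun z => ?_
        simp only [Lf]
        have h2 : V z * deriv (St δ) (qf 0 ρ z) ≤ 0 := by
          by_cases h : deriv (St δ) (qf 0 ρ z) = 0
          · simp [h]
          · have hs := dSt_supp hδ h
            exact mul_nonpos_of_nonpos_of_nonneg (shell δ hδ hδη z hs.1 hs.2) (dSt_nonneg hδ _)
        have h3 : 0 ≤ 4 * ‖z - 0‖ ^ 2 := by positivity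
        have := mul_nonpos_of_nonneg_of_nonpos h3 h2
        linarith
      rw [integral_const_mul] at h1
      by_contra! hcon
      have : 0 < 2 * (d:ℝ) * ∫ z, V z * St δ (qf 0 ρ z) := by positivity
      linarith
    -- limit δ → 0
    have hlim : Tendsto (fun n : ℕ => ∫ z, V z * St (1 / ((n:ℝ) + 1)) (qf 0 ρ z)) atTop
        (𝓝 (∫ z, (ball (0 : Euc d) ρ).indicator V z)) := by
      apply tendsto_integral_of_dominated_convergence
        (bound := (closedBall (0 : Euc d) ρ).indicator (fun _ => 2 * M + ε))
      · intro n
        exact (hVc.mul ((St_cont _).comp (qf_contDiff 0 ρ).continuous)).aestronglyMeasurable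
      · rw [integrable_indicator_iff isClosed_closedBall.measurableSet]
        exact integrableOn_const (isCompact_closedBall _ _).measure_lt_top.ne
      · intro n
        refine Eventually.of_forall fun z => ?_
        have hδ : 0 < 1 / ((n:ℝ) + 1) := by positivity
        by_cases hz : z ∈ closedBall (0 : Euc d) ρ
        · rw [indicator_of_mem hz, norm_mul, Real.norm_eq_abs, Real.norm_eq_abs, abs_of_nonneg (St_nonneg _ _)]
          have h1 : |V z| ≤ 2 * M + ε := by
            have a1 := abs_le.1 (hWM z)
            have a2 := abs_le.1 (hWM x)
            simp only [hV]
            rw [abs_le]; constructor <;> linarith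
          have := mul_le_mul h1 (St_le_one (1 / ((n:ℝ) + 1)) (qf 0 ρ z)) (St_nonneg _ _) ((abs_nonneg _).trans h1)
          linarith
        · rw [indicator_of_notMem hz, St_zero hδ (qf_neg hρ hz)]; simp
      · refine Eventually.of_forall fun z => ?_
        by_cases hz : z ∈ ball (0 : Euc d) ρ
        · rw [indicator_of_mem hz]
          have hzn : ‖z‖ < ρ := by simpa using hz
          have hq : 0 < qf 0 ρ z := by
            simp only [qf, sub_zero]; nlinarith [norm_nonneg z]
          apply tendsto_const_nhds.congr'
          filter_upwards [(tendsto_one_div_add_atTop_nhds_zero_nat (𝕜 := ℝ)).eventually (Iio_mem_nhds hq)] with n hn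
          rw [St_one (by positivity) (le_of_lt hn), mul_one]
        · rw [indicator_of_notMem hz]
          apply tendsto_const_nhds.congr
          intro n
          have hzn : ρ ≤ ‖z‖ := by simpa using hz
          rw [St_zero (by positivity), mul_zero]
          simp only [qf, sub_zero]; nlinarith
    rw [integral_indicator measurableSet_ball] at hlim
    refine le_of_tendsto hlim ?_
    have hηρ : 0 < η * ρ ^ 2 := by positivity
    filter_upwards [(tendsto_one_div_add_atTop_nhds_zero_nat (𝕜 := ℝ)).eventually (Iio_mem_nhds hηρ)] with n hn
    exact step _ (by positivity) hn
  have hint : IntegrableOn (fun z => W z - W x) (ball (0 : Euc d) ρ) :=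
    ((hWc.sub continuous_const).continuousOn.integrableOn_compact (isCompact_closedBall 0 ρ)).mono_set
      ball_subset_closedBall
  have h1 : ∀ ε > 0, (∫ z in ball (0 : Euc d) ρ, (W z - W x)) ≤ ε * volume.real (ball (0 : Euc d) ρ) := by
    intro ε hε
    have := main ε hε
    rw [integral_sub hint (integrableOn_const measure_ball_lt_top.ne)] at this
    simp at this
    linarith
  have h3 : Tendsto (fun t : ℝ => t * volume.real (ball (0 : Euc d) ρ)) (𝓝[>] 0) (𝓝 0) := by
    have : Continuous (fun t : ℝ => t * volume.real (ball (0 : Euc d) ρ)) := by fun_prop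
    have := this.tendsto 0
    simp only [zero_mul] at this
    exact this.mono_left nhdsWithin_le_nhds
  exact ge_of_tendsto h3 (by filter_upwards [self_mem_nhdsWithin] with t ht using h1 t ht)

lemma RSym_ball (w : Euc d → ℝ) (hw : Continuous w) (M : ℝ) (hM : ∀ x, |w x| ≤ M) (c : Euc d) (s : ℝ) :
    ∫ z in ball (0 : Euc d) s, RSym w c z = ∫ z in ball c s, w z := by
  have hk : Integrable ((ball (0 : Euc d) s).indicator (fun _ => (1:ℝ))) := by
    rw [integrable_indicator_iff measurableSet_ball]
    exact integrableOn_const measure_ball_lt_top.ne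
  have h := RSym_integral w hw M hM c _ hk (by
    intro g x
    have : act g x ∈ ball (0 : Euc d) s ↔ x ∈ ball (0 : Euc d) s := by simp [norm_act]
    by_cases hx : x ∈ ball (0 : Euc d) s
    · rw [indicator_of_mem hx, indicator_of_mem (this.2 hx)]
    · rw [indicator_of_notMem hx, indicator_of_notMem (fun h => hx (this.1 h))])
  have e1 : (fun z => RSym w c z * (ball (0 : Euc d) s).indicator (fun _ => (1:ℝ)) z) =
      (ball (0 : Euc d) s).indicator (RSym w c) := by
    funext z
    by_cases hz : z ∈ ball (0 : Euc d) s
    · simp [indicator_of_mem hz]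
    · simp [indicator_of_notMem hz]
  have e2 : (fun z => w (c + z) * (ball (0 : Euc d) s).indicator (fun _ => (1:ℝ)) z) =
      fun z => (ball c s).indicator w (c + z) := by
    funext z
    have : c + z ∈ ball c s ↔ z ∈ ball (0 : Euc d) s := by simp
    by_cases hz : z ∈ ball (0 : Euc d) s
    · rw [indicator_of_mem hz, indicator_of_mem (this.2 hz), mul_one]
    · rw [indicator_of_notMem hz, indicator_of_notMem (fun h => hz (this.1 h)), mul_zero]
  rw [e1, e2] at h
  rw [← integral_indicator measurableSet_ball, ← integral_indicator measurableSet_ball, h]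
  exact integral_add_left_eq_self ((ball c s).indicator w) c

lemma RSym_min (hd : 0 < d) (w : Euc d → ℝ) (hw : Continuous w) (M : ℝ) (hM : ∀ x, |w x| ≤ M)
    (c : Euc d) (s : ℝ) (hs : 0 < s)
    (hH : ∀ ρ, 0 < ρ → ρ ≤ s → ∀ δ > 0, 0 ≤ ∫ z, w z * Lf c ρ δ z) (z : Euc d) (hz : ‖z‖ ≤ s) :
    w c ≤ RSym w c z := by
  have hWc : Continuous (RSym w c) := RSym_continuous w hw M hM c
  obtain ⟨x, hxm, hx⟩ := (isCompact_closedBall (0 : Euc d) s).exists_isMinOn ⟨0, by simp [hs.le]⟩ hWc.continuousOn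
  have hxs : ‖x‖ ≤ s := by simpa using hxm
  have hmin : ∀ y : Euc d, ‖y‖ ≤ s → RSym w c x ≤ RSym w c y := fun y hy => hx (by simpa using hy)
  suffices RSym w c 0 = RSym w c x by
    rw [← RSym_zero w c, this]; exact hmin z hz
  by_cases hx0 : x = 0
  · rw [hx0]
  have hρ : 0 < ‖x‖ := norm_pos_iff.2 hx0
  have h1 := core hd w hw M hM c x hx0 (hH _ hρ hxs)
  by_contra hne
  have hgt : 0 < RSym w c 0 - RSym w c x := by
    have := hmin 0 (by simp [hs.le])
    exact sub_pos.2 (lt_of_le_of_ne this (Ne.symm hne))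
  have hVc : Continuous (fun y => RSym w c y - RSym w c x) := hWc.sub continuous_const
  have hint : IntegrableOn (fun y => RSym w c y - RSym w c x) (ball (0 : Euc d) ‖x‖) :=
    (hVc.continuousOn.integrableOn_compact (isCompact_closedBall 0 ‖x‖)).mono_set
      ball_subset_closedBall
  have h2 : 0 < ∫ y in ball (0 : Euc d) ‖x‖, (RSym w c y - RSym w c x) := by
    rw [setIntegral_pos_iff_support_of_nonneg_ae _ hint]
    · have ho : IsOpen (Function.support (fun y => RSym w c y - RSym w c x) ∩ ball (0 : Euc d) ‖x‖) :=
        hVc.isOpen_support.inter isOpen_ball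
      exact ho.measure_pos _ ⟨0, hgt.ne', by simpa using hρ⟩
    · refine (ae_restrict_iff' measurableSet_ball).2 (Eventually.of_forall fun y hy => ?_)
      have : ‖y‖ < ‖x‖ := by simpa using hy
      exact sub_nonneg.2 (hmin y (this.le.trans hxs))
  linarith

lemma interior_bound (hd : 0 < d) (D : Set (Euc d)) (lama M : ℝ) (u : Euc d → ℝ) (hu : MemH10 D u)
    (hnn : ∀ x, 0 ≤ u x) (hM : ∀ x, u x ≤ M) (huc : ContinuousOn u D)
    (hsub : ∀ φ : Euc d → ℝ, TestFun D φ → (∀ x, 0 ≤ φ x) →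
      (∫ x, ⟪gradient u x, gradient φ x⟫) ≤ lama * ∫ x, u x * φ x)
    (x₀ : Euc d) (r : ℝ) (hr : 0 < r) (hD : closedBall x₀ r ⊆ D) (y : Euc d) (hy : y ∈ ball x₀ (r / 2)) :
    u y ≤ 2 ^ d * (sphAvg u x₀ r + |lama| * M / (2 * d) * r ^ 2) := by
  have hd' : (0:ℝ) < d := by exact_mod_cast hd
  have hM0 : 0 ≤ M := (hnn 0).trans (hM 0)
  set κ := |lama| * M / (2 * d) with hκ
  have hκ0 : 0 ≤ κ := by positivity
  set v : Euc d → ℝ := fun x => u x + κ * ‖x - x₀‖ ^ 2 with hv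
  have hvc : ContinuousOn v (closedBall x₀ r) :=
    (huc.mono hD).add (by fun_prop)
  obtain ⟨w0, hw0⟩ := ContinuousMap.exists_restrict_eq (isClosed_closedBall (x := x₀) (ε := r))
    ⟨_, hvc.domRestrict⟩
  set M' := M + κ * r ^ 2 with hM'
  have hM'0 : 0 ≤ M' := by positivity
  have hv0 : ∀ x, 0 ≤ v x := fun x => by have := hnn x; simp only [hv]; positivity
  have hvM : ∀ x ∈ closedBall x₀ r, v x ≤ M' := by
    intro x hx
    have h1 : ‖x - x₀‖ ≤ r := by simpa [dist_eq_norm] using hx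
    have h2 : ‖x - x₀‖ ^ 2 ≤ r ^ 2 := by gcongr
    have := mul_le_mul_of_nonneg_left h2 hκ0
    simp only [hv, hM']; linarith [hM x]
  set w : Euc d → ℝ := fun x => max 0 (min (w0 x) M') with hw
  have hwc : Continuous w := continuous_const.max (w0.continuous.min continuous_const)
  have hwnn : ∀ x, 0 ≤ w x := fun x => le_max_left _ _
  have hwM : ∀ x, |w x| ≤ M' := fun x => by
    rw [abs_of_nonneg (hwnn x)]; exact max_le hM'0 (min_le_right _ _)
  have hwv : ∀ x ∈ closedBall x₀ r, w x = v x := by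
    intro x hx
    have h1 : w0 x = v x := by
      have := congrArg (fun f => f ⟨x, hx⟩) hw0
      simpa using this
    simp only [hw, h1]
    rw [min_eq_left (hvM x hx), max_eq_right (hv0 x)]
  have hH : ∀ c ρ, 0 < ρ → closedBall c ρ ⊆ closedBall x₀ r → ∀ δ > 0, 0 ≤ ∫ z, w z * Lf c ρ δ z := by
    intro c ρ hρ hcr δ hδ
    have h1 := weak_sub hd D lama M u hu hnn hM hsub c x₀ hρ hδ (hcr.trans hD)
    have h2 : ∀ z, w z * Lf c ρ δ z = (u z + (|lama| * M) / (2 * d) * ‖z - x₀‖ ^ 2) * Lf c ρ δ z := by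
      intro z
      by_cases hz : z ∈ closedBall c ρ
      · rw [hwv z (hcr hz)]
      · rw [Lf_zero c hρ hδ hz]; simp
    simp_rw [h2]; exact h1
  -- center y
  have hyd : dist y x₀ < r / 2 := hy
  have hs : 0 < r / 2 := by positivity
  have hymem : y ∈ closedBall x₀ r := by rw [mem_closedBall]; linarith
  have hwint : ∀ (c : Euc d) (s : ℝ), IntegrableOn w (ball c s) := fun c s =>
    (hwc.continuousOn.integrableOn_compact (isCompact_closedBall c s)).mono_set ball_subset_closedBall
  have hWint : ∀ (c : Euc d) (s : ℝ), IntegrableOn (RSym w c) (ball 0 s) := fun c s =>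
    ((RSym_continuous w hwc M' hwM c).continuousOn.integrableOn_compact
      (isCompact_closedBall 0 s)).mono_set ball_subset_closedBall
  have A1 : w y * volume.real (ball (0 : Euc d) (r / 2)) ≤ ∫ z in ball y (r / 2), w z := by
    rw [← RSym_ball w hwc M' hwM y (r / 2)]
    have : ∫ z in ball (0 : Euc d) (r / 2), w y ≤ ∫ z in ball (0 : Euc d) (r / 2), RSym w y z := by
      refine setIntegral_mono_on (integrableOn_const measure_ball_lt_top.ne) (hWint _ _) measurableSet_ball ?_
      intro z hz
      have hz' : ‖z‖ < r / 2 := by simpa using hz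
      refine RSym_min hd w hwc M' hwM y (r / 2) hs ?_ z hz'.le
      intro ρ hρ hρs
      refine hH y ρ hρ (closedBall_subset_closedBall' (by linarith))
    simpa [mul_comm] using this
  have A2 : ∫ z in ball y (r / 2), w z ≤ ∫ z in ball x₀ r, w z := by
    refine setIntegral_mono_set (hwint _ _) (Eventually.of_forall hwnn) ?_
    exact (ball_subset_ball' (by linarith)).eventuallyLE
  obtain ⟨x, hx⟩ := exists_norm hd r hr.le
  have hx0 : x ≠ 0 := by rintro rfl; simp at hx; linarith
  have A3 : ∫ z in ball x₀ r, w z ≤ RSym w x₀ x * volume.real (ball (0 : Euc d) r) := by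
    rw [← RSym_ball w hwc M' hwM x₀ r]
    have := core hd w hwc M' hwM x₀ x hx0 (by rw [hx]; exact hH x₀ r hr subset_rfl)
    rw [hx, integral_sub (hWint _ _) (integrableOn_const measure_ball_lt_top.ne)] at this
    simp at this
    linarith
  have A4 : RSym w x₀ x = sphAvg u x₀ r + κ * r ^ 2 := by
    rw [← sphAvg_eq_RSym hd w x₀ x hx0 hwc.aestronglyMeasurable, hx]
    have hpos := sphere_pos hd x₀ r hr
    have hfin := sphere_fin hd x₀ r hr
    have hpr := ENNReal.toReal_pos hpos.ne' hfin.ne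
    unfold sphAvg
    have e1 : ∫ y in sphere x₀ r, w y ∂(μH[(d : ℝ) - 1]) =
        ∫ y in sphere x₀ r, (u y + κ * r ^ 2) ∂(μH[(d : ℝ) - 1]) := by
      apply setIntegral_congr_fun isClosed_sphere.measurableSet
      intro z hz
      have hz' : ‖z - x₀‖ = r := by simpa [dist_eq_norm] using hz
      simp only [hwv z (sphere_subset_closedBall hz), hv, hz']
    have hui : IntegrableOn u (sphere x₀ r) (μH[(d : ℝ) - 1]) := by
      haveI : IsFiniteMeasure ((μH[(d : ℝ) - 1] : Measure (Euc d)).restrict (sphere x₀ r)) :=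
        ⟨by rw [Measure.restrict_apply_univ]; exact hfin⟩
      refine Integrable.of_bound (C := M) ?_ (Eventually.of_forall fun z => ?_)
      · exact ((huc.mono hD).mono sphere_subset_closedBall).aestronglyMeasurable isClosed_sphere.measurableSet
      · rw [Real.norm_of_nonneg (hnn z)]; exact hM z
    rw [e1, integral_add hui (integrableOn_const hfin.ne), setIntegral_const, measureReal_def, smul_eq_mul]
    field_simp
  have hvol : volume.real (ball (0 : Euc d) r) = 2 ^ d * volume.real (ball (0 : Euc d) (r / 2)) := by
    have := Measure.addHaar_ball_mul_of_pos (volume : Measure (Euc d)) 0 (r := 2) (by norm_num) (r / 2)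
    rw [show 2 * (r / 2) = r by ring] at this
    rw [measureReal_def, measureReal_def, this, ENNReal.toReal_mul, ENNReal.toReal_ofReal (by positivity)]
    simp
  have hvp : 0 < volume.real (ball (0 : Euc d) (r / 2)) :=
    ENNReal.toReal_pos (measure_ball_pos _ _ hs).ne' measure_ball_lt_top.ne
  rw [hvol, A4] at A3
  have hfinal : w y ≤ 2 ^ d * (sphAvg u x₀ r + κ * r ^ 2) := by
    have := A1.trans (A2.trans A3)
    by_contra! hc
    have := mul_lt_mul_of_pos_right hc hvp
    nlinarith
  have : u y ≤ w y := by
    rw [hwv y hymem]; simp only [hv]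
    have : 0 ≤ κ * ‖y - x₀‖ ^ 2 := by positivity
    linarith
  linarith

lemma one_dim_mp (hd : d = 1) (p e : Euc d) (he : ‖e‖ = 1) :
    MeasurePreserving (fun t : ℝ => p + t • e) volume (volume : Measure (Euc d)) := by
  have he0 : e ≠ 0 := by rintro rfl; simp at he
  have hfr : Module.finrank ℝ (Euc d) = 1 := by simp [hd]
  let l : ℝ →ₗᵢ[ℝ] Euc d := LinearIsometry.toSpanSingleton ℝ (Euc d) he
  let L : ℝ ≃ₗᵢ[ℝ] Euc d := l.toLinearIsometryEquiv (by simp [hfr])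
  have h1 := L.measurePreserving
  have h2 := (measurePreserving_add_left (volume : Measure (Euc d)) p).comp h1
  exact h2

lemma one_dim_hold (hd : d = 1) (ψ : Euc d → ℝ) (hψ : ContDiff ℝ (⊤ : ℕ∞) ψ) (hcs : HasCompactSupport ψ)
    (p z : Euc d) (hp : ψ p = 0) : ψ z ^ 2 ≤ ‖z - p‖ * ∫ x, ‖gradient ψ x‖ ^ 2 := by
  by_cases hz : z = p
  · subst hz; simp [hp]
  obtain ⟨ℓ, hℓ⟩ : ∃ ℓ, ℓ = ‖z - p‖ := ⟨_, rfl⟩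
  have hℓ0 : 0 < ℓ := by rw [hℓ]; exact norm_pos_iff.2 (sub_ne_zero.2 hz)
  obtain ⟨e, hen, hze⟩ : ∃ e : Euc d, ‖e‖ = 1 ∧ p + ℓ • e = z := by
    refine ⟨ℓ⁻¹ • (z - p), ?_, ?_⟩
    · rw [norm_smul, norm_inv, ← hℓ, Real.norm_of_nonneg hℓ0.le, inv_mul_cancel₀ hℓ0.ne']
    · rw [smul_smul, mul_inv_cancel₀ hℓ0.ne', one_smul]; abel
  rw [← hℓ]
  have hmp := one_dim_mp hd p e hen
  have hgc : Continuous (gradient ψ) := grad_cont (hψ.of_le (by exact_mod_cast le_top))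
  have hgcs : HasCompactSupport (gradient ψ) := grad_cs hcs
  have hgi : Integrable (fun x => ‖gradient ψ x‖ ^ 2) :=
    (hgc.memLp_of_hasCompactSupport hgcs (p := 2)).integrable_norm_pow (by norm_num)
  have hme : MeasurableEmbedding (fun t : ℝ => p + t • e) := by
    have hcm : Continuous (fun t : ℝ => p + t • e) := by fun_prop
    refine hcm.measurableEmbedding ?_
    intro s t hst
    have he0 : e ≠ 0 := by intro h; simp [h] at hen
    simpa using smul_left_injective ℝ he0 (add_left_cancel hst)
  have h3 : ∫ t : ℝ, ‖gradient ψ (p + t • e)‖ ^ 2 = ∫ x, ‖gradient ψ x‖ ^ 2 :=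
    hmp.integral_comp hme (fun x => ‖gradient ψ x‖ ^ 2)
  have h4 : Integrable (fun t : ℝ => ‖gradient ψ (p + t • e)‖ ^ 2) :=
    hmp.integrable_comp_of_integrable hgi
  have hder : ∀ t : ℝ, HasDerivAt (fun t : ℝ => ψ (p + t • e)) ⟪gradient ψ (p + t • e), e⟫ t := by
    intro t
    have hdiff : DifferentiableAt ℝ ψ (p + t • e) := (hψ.differentiable (by simp)) _
    have h5 := hdiff.hasFDerivAt
    have h6 : HasDerivAt (fun t : ℝ => p + t • e) e t := by
      simpa using ((hasDerivAt_id t).smul_const e).const_add p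
    have h7 := h5.comp_hasDerivAt t h6
    have h8 : ⟪gradient ψ (p + t • e), e⟫ = fderiv ℝ ψ (p + t • e) e := by simp [gradient]
    rw [h8]; exact h7
  have hcd : Continuous (fun t : ℝ => ⟪gradient ψ (p + t • e), e⟫) :=
    (hgc.comp (by fun_prop)).inner continuous_const
  have hftc : ∫ t in (0:ℝ)..ℓ, ⟪gradient ψ (p + t • e), e⟫ = ψ z := by
    rw [intervalIntegral.integral_eq_sub_of_hasDerivAt (fun t _ => hder t) (hcd.intervalIntegrable _ _)]
    simp [hze, hp]
  have hsq : ∫ t in (0:ℝ)..ℓ, ⟪gradient ψ (p + t • e), e⟫ ^ 2 ≤ ∫ x, ‖gradient ψ x‖ ^ 2 := by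
    rw [← h3, intervalIntegral.integral_of_le hℓ0.le]
    calc _ ≤ ∫ t in Ioc 0 ℓ, ‖gradient ψ (p + t • e)‖ ^ 2 := by
          refine integral_mono (((hcd.pow 2).intervalIntegrable 0 ℓ).1) h4.integrableOn ?_
          intro t
          have := abs_real_inner_le_norm (gradient ψ (p + t • e)) e
          rw [hen, mul_one] at this
          simpa using sq_le_sq' (by linarith [neg_abs_le ⟪gradient ψ (p + t • e), e⟫]) ((le_abs_self _).trans this)
      _ ≤ _ := setIntegral_le_integral h4 (Eventually.of_forall fun t => by positivity)
  have hpos : 0 ≤ ∫ t in (0:ℝ)..ℓ, (⟪gradient ψ (p + t • e), e⟫ - ψ z / ℓ) ^ 2 :=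
    intervalIntegral.integral_nonneg hℓ0.le (fun t _ => sq_nonneg _)
  have hexp : ∫ t in (0:ℝ)..ℓ, (⟪gradient ψ (p + t • e), e⟫ - ψ z / ℓ) ^ 2 =
      (∫ t in (0:ℝ)..ℓ, ⟪gradient ψ (p + t • e), e⟫ ^ 2) - ψ z ^ 2 / ℓ := by
    have : ∀ t : ℝ, (⟪gradient ψ (p + t • e), e⟫ - ψ z / ℓ) ^ 2 = ⟪gradient ψ (p + t • e), e⟫ ^ 2
      - (2 * (ψ z / ℓ)) * ⟪gradient ψ (p + t • e), e⟫ + (ψ z / ℓ) ^ 2 := fun t => by ring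
    simp_rw [this]
    rw [intervalIntegral.integral_add, intervalIntegral.integral_sub, intervalIntegral.integral_const_mul, hftc,
      intervalIntegral.integral_const]
    · simp; field_simp; ring
    · exact (hcd.pow 2).intervalIntegrable _ _
    · exact (continuous_const.mul hcd).intervalIntegrable _ _
    · exact ((hcd.pow 2).sub (continuous_const.mul hcd)).intervalIntegrable _ _
    · exact continuous_const.intervalIntegrable _ _
  rw [hexp] at hpos
  have : ψ z ^ 2 / ℓ ≤ ∫ x, ‖gradient ψ x‖ ^ 2 := by linarith
  rw [div_le_iff₀ hℓ0] at this
  linarith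

lemma one_dim_bound (hd : d = 1) (D : Set (Euc d)) (hD : IsOpen D) (u : Euc d → ℝ) (hu : MemH10 D u)
    (huc : ContinuousOn u D) (hnn : ∀ x, 0 ≤ u x) (p : Euc d) (hp : p ∉ D) :
    ∃ L, 0 ≤ L ∧ ∀ z ∈ D, u z ≤ √(L * ‖z - p‖) := by
  obtain ⟨h2, hg2, ψ, hψ, hlim⟩ := hu
  have hL0 : 0 ≤ ∫ x, ‖gradient u x‖ ^ 2 := integral_nonneg fun x => by positivity
  set L := 2 * (∫ x, ‖gradient u x‖ ^ 2) + 2 with hL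
  refine ⟨L, by positivity, ?_⟩
  have hgi : Integrable (fun x => ‖gradient u x‖ ^ 2) := hg2.integrable_norm_pow (by norm_num)
  have hui : Integrable (fun x => u x ^ 2) := h2.integrable_sq
  have hψ2 : ∀ n, MemLp (ψ n) 2 (volume : Measure (Euc d)) := fun n =>
    (hψ n).1.continuous.memLp_of_hasCompactSupport (hψ n).2.1
  have hψg : ∀ n, MemLp (gradient (ψ n)) 2 (volume : Measure (Euc d)) := fun n =>
    (grad_cont ((hψ n).1.of_le (by exact_mod_cast le_top))).memLp_of_hasCompactSupport (grad_cs (hψ n).2.1)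
  have i1 : ∀ n, Integrable (fun x => (u x - ψ n x) ^ 2) := fun n => (h2.sub (hψ2 n)).integrable_sq
  have i2 : ∀ n, Integrable (fun x => ‖gradient u x - gradient (ψ n) x‖ ^ 2) := fun n =>
    (hg2.sub (hψg n)).integrable_norm_pow (by norm_num)
  have i3 : ∀ n, Integrable (fun x => ‖gradient (ψ n) x‖ ^ 2) := fun n =>
    (hψg n).integrable_norm_pow (by norm_num)
  set I := fun n => ∫ x, ((u x - ψ n x) ^ 2 + ‖gradient u x - gradient (ψ n) x‖ ^ 2) with hI
  have hIs : ∀ n, I n = (∫ x, (u x - ψ n x) ^ 2) + ∫ x, ‖gradient u x - gradient (ψ n) x‖ ^ 2 :=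
    fun n => integral_add (i1 n) (i2 n)
  have hn1 : ∀ n, 0 ≤ ∫ x, (u x - ψ n x) ^ 2 := fun n => integral_nonneg fun x => by positivity
  have hn2 : ∀ n, 0 ≤ ∫ x, ‖gradient u x - gradient (ψ n) x‖ ^ 2 := fun n => integral_nonneg fun x => by positivity
  have hev : ∀ᶠ n in atTop, ∀ z, ψ n z ^ 2 ≤ L * ‖z - p‖ := by
    filter_upwards [hlim.eventually (gt_mem_nhds (zero_lt_one' ℝ))] with n hn z
    have hn : I n < 1 := hn
    have h5 := one_dim_hold hd (ψ n) (hψ n).1 (hψ n).2.1 p z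
      (image_eq_zero_of_notMem_tsupport fun h => hp ((hψ n).2.2 h))
    have h6 : ∫ x, ‖gradient (ψ n) x‖ ^ 2 ≤
        ∫ x, (2 * ‖gradient u x‖ ^ 2 + 2 * ‖gradient u x - gradient (ψ n) x‖ ^ 2) := by
      refine integral_mono (i3 n) ((hgi.const_mul 2).add ((i2 n).const_mul 2)) ?_
      intro x
      have h7 : ‖gradient (ψ n) x‖ ≤ ‖gradient u x‖ + ‖gradient u x - gradient (ψ n) x‖ := by
        have := norm_sub_le (gradient u x) (gradient u x - gradient (ψ n) x)
        simpa using this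
      have h8 := norm_nonneg (gradient (ψ n) x)
      simp only
      nlinarith [sq_nonneg (‖gradient u x‖ - ‖gradient u x - gradient (ψ n) x‖)]
    rw [integral_add (hgi.const_mul 2) ((i2 n).const_mul 2), integral_const_mul, integral_const_mul] at h6
    have h9 := hIs n
    have h10 : ∫ x, ‖gradient (ψ n) x‖ ^ 2 ≤ L := by linarith [hn1 n]
    nlinarith [norm_nonneg (z - p)]
  set h : Euc d → ℝ := fun z => max 0 (u z - √(L * ‖z - p‖)) with hh
  have hhm : AEStronglyMeasurable h volume := by
    have hm : AEStronglyMeasurable (fun z => u z - √(L * ‖z - p‖)) volume :=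
      h2.aestronglyMeasurable.sub (by fun_prop)
    exact aestronglyMeasurable_const.sup hm
  have hh0 : ∀ z, 0 ≤ h z := fun z => le_max_left _ _
  have hhu : ∀ z, h z ≤ u z := fun z => max_le (hnn z) (by linarith [Real.sqrt_nonneg (L * ‖z - p‖)])
  have hhi : Integrable (fun z => h z ^ 2) := by
    refine hui.mono (hhm.pow 2) (Eventually.of_forall fun z => ?_)
    simp only [norm_pow, Real.norm_of_nonneg (hh0 z), Real.norm_of_nonneg (hnn z)]
    exact pow_le_pow_left₀ (hh0 z) (hhu z) 2
  have hle : ∫ z, h z ^ 2 ≤ 0 := by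
    refine ge_of_tendsto hlim ?_
    filter_upwards [hev] with n hn
    have : ∫ z, h z ^ 2 ≤ ∫ z, (u z - ψ n z) ^ 2 := by
      refine integral_mono hhi (i1 n) fun z => ?_
      have h11 : ψ n z ≤ √(L * ‖z - p‖) := Real.le_sqrt_of_sq_le (hn z)
      rcases le_total (u z - √(L * ‖z - p‖)) 0 with h12 | h12
      · simp only [hh, max_eq_left h12]; rw [zero_pow (by norm_num)]; exact sq_nonneg _
      · simp only [hh, max_eq_right h12]
        exact pow_le_pow_left₀ h12 (by linarith) 2
    exact this.trans ((le_add_of_nonneg_right (hn2 n)).trans (hIs n).ge)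
  have hz0 : ∫ z, h z ^ 2 = 0 := le_antisymm hle (integral_nonneg fun z => sq_nonneg (h z))
  have hae := (integral_eq_zero_iff_of_nonneg (fun z => sq_nonneg (h z)) hhi).1 hz0
  intro z hz
  by_contra! hlt
  have hhc : ContinuousOn (fun z => u z - √(L * ‖z - p‖)) D := huc.sub (by fun_prop)
  have hop : IsOpen (D ∩ (fun z => u z - √(L * ‖z - p‖)) ⁻¹' Ioi 0) := hhc.isOpen_inter_preimage hD isOpen_Ioi
  have hmp := hop.measure_pos volume ⟨z, hz, by simpa using hlt⟩
  refine hmp.ne' (measure_mono_null ?_ hae)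
  rintro x ⟨_, hx⟩ hx'
  have hx1 : 0 < u x - √(L * ‖x - p‖) := hx
  have : h x ^ 2 = 0 := hx'
  have : h x = 0 := by simpa using this
  simp only [hh, max_eq_right hx1.le] at this
  linarith

lemma ball_sub_norm (hd : 0 < d) (x₀ xc : Euc d) (r R : ℝ) (hr : 0 < r) (h : ball x₀ r ⊆ ball xc R) :
    ‖x₀ - xc‖ + r ≤ R := by
  have h1 : closedBall x₀ r ⊆ closedBall xc R := by
    rw [← closure_ball x₀ hr.ne']
    exact closure_minimal (h.trans ball_subset_closedBall) isClosed_closedBall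
  obtain ⟨e, he, hv⟩ : ∃ e : Euc d, ‖e‖ = 1 ∧ x₀ - xc = ‖x₀ - xc‖ • e := by
    by_cases h0 : x₀ - xc = 0
    · obtain ⟨e, he⟩ := exists_norm hd 1 zero_le_one
      exact ⟨e, he, by simp [h0]⟩
    · have hn := norm_pos_iff.2 h0
      refine ⟨‖x₀ - xc‖⁻¹ • (x₀ - xc), ?_, ?_⟩
      · rw [norm_smul, norm_inv, norm_norm, inv_mul_cancel₀ hn.ne']
      · rw [smul_smul, mul_inv_cancel₀ hn.ne', one_smul]
  have h2 : x₀ + r • e ∈ closedBall xc R := h1 (by simp [norm_smul, he, abs_of_pos hr])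
  rw [mem_closedBall, dist_eq_norm, show x₀ + r • e - xc = (x₀ - xc) + r • e by abel, hv, ← add_smul,
    norm_smul, he, mul_one, Real.norm_of_nonneg (by positivity)] at h2
  exact h2

lemma sphere_touch (x₀ xc : Euc d) (r R : ℝ) (hr : 0 < r) (hrR : r < R)
    (h : ‖x₀ - xc‖ + r ≤ R) : ∃ p, ∀ z ∈ sphere x₀ r, z ∈ ball xc R ∨ z = p := by
  refine ⟨x₀ + (r / ‖x₀ - xc‖) • (x₀ - xc), fun z hz => ?_⟩
  by_cases hb : z ∈ ball xc R
  · exact Or.inl hb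
  right
  have hzn : ‖z - x₀‖ = r := by simpa [dist_eq_norm] using hz
  have h1 : R ≤ ‖(x₀ - xc) + (z - x₀)‖ := by
    have : R ≤ dist z xc := by simpa using hb
    rwa [dist_eq_norm, show z - xc = (x₀ - xc) + (z - x₀) by abel] at this
  have h2 := norm_add_le (x₀ - xc) (z - x₀)
  have h3 : ‖(x₀ - xc) + (z - x₀)‖ = ‖x₀ - xc‖ + ‖z - x₀‖ := by linarith
  have h4 := (sameRay_iff_norm_add.2 h3).norm_smul_eq
  have h5 : 0 < ‖x₀ - xc‖ := by linarith
  rw [hzn] at h4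
  have h6 : z - x₀ = (r / ‖x₀ - xc‖) • (x₀ - xc) := by
    rw [div_eq_inv_mul, mul_smul, ← h4, smul_smul, inv_mul_cancel₀ h5.ne', one_smul]
  rw [← h6]; abel

lemma limit_bound (hd : 0 < d) (D : Set (Euc d)) (hDo : IsOpen D) (lama M : ℝ) (u : Euc d → ℝ) (hu : MemH10 D u)
    (hnn : ∀ x, 0 ≤ u x) (hM : ∀ x, u x ≤ M) (huc : ContinuousOn u D)
    (hsub : ∀ φ : Euc d → ℝ, TestFun D φ → (∀ x, 0 ≤ φ x) →
      (∫ x, ⟪gradient u x, gradient φ x⟫) ≤ lama * ∫ x, u x * φ x)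
    (x₀ : Euc d) (r : ℝ) (hr : 0 < r) (hD : ball x₀ r ⊆ D)
    (p : Euc d) (hp : ∀ z ∈ sphere x₀ r, z ∈ D ∨ z = p)
    (y : Euc d) (hy : y ∈ ball x₀ (r / 2)) :
    u y ≤ 2 ^ d * (sphAvg u x₀ r + |lama| * M / (2 * d) * r ^ 2) := by
  obtain ⟨x, hx⟩ := exists_norm hd r hr.le
  have hx0 : x ≠ 0 := by rintro rfl; simp at hx; linarith
  have hum : AEStronglyMeasurable u ((μH[(d : ℝ) - 1] : Measure (Euc d)).restrict (sphere x₀ ‖x‖)) := by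
    have h1 : AEStronglyMeasurable u ((μH[(d : ℝ) - 1] : Measure (Euc d)).restrict (D ∪ {p})) := by
      rw [aestronglyMeasurable_union_iff]
      refine ⟨huc.aestronglyMeasurable hDo.measurableSet, ?_⟩
      exact (aestronglyMeasurable_const (b := u p)).congr
        ((ae_restrict_iff' (measurableSet_singleton p)).2 (Eventually.of_forall fun z hz => by
          rw [mem_singleton_iff.1 hz]))
    refine h1.mono_measure (Measure.restrict_mono_set _ ?_)
    intro z hz
    rw [hx] at hz
    exact hp z hz
  have hsph : ∀ g, x₀ + act g x ∈ sphere x₀ r := fun g => by simp [norm_act, hx]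
  have hcontg : Continuous (fun g : Gd d => x₀ + act g x) :=
    continuous_const.add (cont_act continuous_id continuous_const)
  have huG : AEStronglyMeasurable (fun g => u (x₀ + act g x)) (hG d) := by
    have : AEStronglyMeasurable u ((hG d).map (fun g => x₀ + act g x)) := by
      rw [← sphere_map hd x₀ x hx0]; exact hum.smul_measure _
    exact this.comp_aemeasurable hcontg.aemeasurable
  have huGi : Integrable (fun g => u (x₀ + act g x)) (hG d) :=
    Integrable.of_bound huG M (Eventually.of_forall fun g => by
      rw [Real.norm_of_nonneg (hnn _)]; exact hM _)
  set F : Gd d → ℝ := fun g => D.indicator u (x₀ + act g x) with hF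
  have hFle : ∫ g, F g ∂(hG d) ≤ sphAvg u x₀ r := by
    have : sphAvg u x₀ r = RSym u x₀ x := by
      rw [← hx]; exact sphAvg_eq_RSym hd u x₀ x hx0 hum
    rw [this]
    refine integral_mono_of_nonneg (Eventually.of_forall fun g => indicator_nonneg (fun z _ => hnn z) _) huGi
      (Eventually.of_forall fun g => indicator_le_self' (fun z _ => hnn z) _)
  have hmem : ∀ t : ℝ, 0 < t → t < 1 → ∀ g, x₀ + act g (t • x) ∈ ball x₀ r := by
    intro t ht ht1 g
    rw [mem_ball, dist_eq_norm, add_sub_cancel_left, norm_act, norm_smul, hx, Real.norm_of_nonneg ht.le]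
    nlinarith
  have hI : ∀ᶠ t : ℝ in 𝓝[<] 1, 0 < t ∧ t < 1 := by
    filter_upwards [self_mem_nhdsWithin, mem_nhdsWithin_of_mem_nhds (Ioi_mem_nhds (zero_lt_one' ℝ))] with t h1 h2
    exact ⟨h2, h1⟩
  have htt : Tendsto (fun t : ℝ => t) (𝓝[<] 1) (𝓝 1) := tendsto_id.mono_left nhdsWithin_le_nhds
  have hzt : ∀ g, Tendsto (fun t : ℝ => x₀ + act g (t • x)) (𝓝[<] 1) (𝓝 (x₀ + act g x)) := by
    intro g
    have hc : Continuous (fun t : ℝ => x₀ + act g (t • x)) :=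
      continuous_const.add (cont_act continuous_const (by fun_prop))
    have := (hc.tendsto 1).mono_left (nhdsWithin_le_nhds (s := Iio 1))
    simpa using this
  have hlim : Tendsto (fun t : ℝ => RSym u x₀ (t • x)) (𝓝[<] 1) (𝓝 (∫ g, F g ∂(hG d))) := by
    refine tendsto_integral_filter_of_dominated_convergence (fun _ => M) ?_ ?_ (integrable_const M) ?_
    · filter_upwards [hI] with t ht
      have hc : Continuous (fun g : Gd d => u (x₀ + act g (t • x))) :=
        huc.comp_continuous (continuous_const.add (cont_act continuous_id continuous_const))
          (fun g => hD (hmem t ht.1 ht.2 g))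
      exact hc.aestronglyMeasurable
    · refine Eventually.of_forall fun t => Eventually.of_forall fun g => ?_
      rw [Real.norm_of_nonneg (hnn _)]; exact hM _
    · have hin : ∀ g, x₀ + act g x ∈ D →
          Tendsto (fun t : ℝ => u (x₀ + act g (t • x))) (𝓝[<] 1) (𝓝 (F g)) := by
        intro g hg
        have h1 : ContinuousAt u (x₀ + act g x) := huc.continuousAt (hDo.mem_nhds hg)
        simp only [hF, indicator_of_mem hg]
        exact h1.tendsto.comp (hzt g)
      by_cases hpD : p ∈ D
      · refine Eventually.of_forall fun g => hin g ?_
        rcases hp _ (hsph g) with h | h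
        · exact h
        · rw [h]; exact hpD
      by_cases hd1 : d = 1
      · obtain ⟨L, hL, hb⟩ := one_dim_bound hd1 D hDo u hu huc hnn p hpD
        refine Eventually.of_forall fun g => ?_
        by_cases hg : x₀ + act g x ∈ D
        · exact hin g hg
        have hgp : x₀ + act g x = p := (hp _ (hsph g)).resolve_left hg
        simp only [hF, indicator_of_notMem hg]
        have hc : Continuous (fun z : Euc d => √(L * ‖z - p‖)) := by fun_prop
        have h2 := (hc.tendsto _).comp (hzt g)
        rw [hgp] at h2
        simp only [sub_self, norm_zero, mul_zero, Real.sqrt_zero] at h2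
        refine squeeze_zero' (Eventually.of_forall fun t => hnn _) ?_ h2
        filter_upwards [hI] with t ht
        exact hb _ (hD (hmem t ht.1 ht.2 g))
      · have hd2 : (0:ℝ) < (d:ℝ) - 1 := by
          have : 1 < d := by omega
          have : (1:ℝ) < d := by exact_mod_cast this
          linarith
        haveI := Measure.nullSingletonClass_hausdorff (Euc d) hd2
        have hnull : ((hG d).map (fun g => x₀ + act g x)) {p} = 0 := by
          rw [← sphere_map hd x₀ x hx0, Measure.smul_apply]
          have : ((μH[(d : ℝ) - 1] : Measure (Euc d)).restrict (sphere x₀ ‖x‖)) {p} = 0 :=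
            Measure.restrict_le_self.absolutelyContinuous (measure_singleton p)
          rw [this, smul_zero]
        rw [Measure.map_apply hcontg.measurable (measurableSet_singleton p)] at hnull
        filter_upwards [measure_eq_zero_iff_ae_notMem.1 hnull] with g hg
        exact hin g ((hp _ (hsph g)).resolve_right hg)
  have hyd : dist y x₀ < r / 2 := hy
  have hev : ∀ᶠ t : ℝ in 𝓝[<] 1, u y ≤ 2 ^ d * (RSym u x₀ (t • x) + |lama| * M / (2 * d) * (t * r) ^ 2) := by
    have h3 : ∀ᶠ t : ℝ in 𝓝[<] 1, dist y x₀ < t * r / 2 := by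
      have : Tendsto (fun t : ℝ => t * r / 2) (𝓝[<] 1) (𝓝 (1 * r / 2)) := (htt.mul_const r).div_const 2
      exact this.eventually (lt_mem_nhds (by linarith))
    filter_upwards [hI, h3] with t ht h3
    have htr : 0 < t * r := mul_pos ht.1 hr
    have hcb : closedBall x₀ (t * r) ⊆ D :=
      (closedBall_subset_ball (by nlinarith [ht.2])).trans hD
    have h4 := interior_bound hd D lama M u hu hnn hM huc hsub x₀ (t * r) htr hcb y h3
    have hn : ‖t • x‖ = t * r := by rw [norm_smul, hx, Real.norm_of_nonneg ht.1.le]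
    have h5 : sphAvg u x₀ (t * r) = RSym u x₀ (t • x) := by
      rw [← hn]
      refine sphAvg_eq_RSym hd u x₀ (t • x) (by intro h; rw [h] at hn; simp at hn; rcases hn with h | h <;> linarith [ht.1]) ?_
      rw [hn]
      exact (huc.mono (sphere_subset_closedBall.trans hcb)).aestronglyMeasurable isClosed_sphere.measurableSet
    rwa [h5] at h4
  have hlim2 : Tendsto (fun t : ℝ => 2 ^ d * (RSym u x₀ (t • x) + |lama| * M / (2 * d) * (t * r) ^ 2)) (𝓝[<] 1)
      (𝓝 (2 ^ d * ((∫ g, F g ∂(hG d)) + |lama| * M / (2 * d) * (1 * r) ^ 2))) :=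
    (hlim.add (((htt.mul_const r).pow 2).const_mul _)).const_mul _
  have := ge_of_tendsto hlim2 hev
  rw [one_mul] at this
  refine this.trans ?_
  gcongr

lemma sphAvg_nonneg (u : Euc d → ℝ) (hnn : ∀ x, 0 ≤ u x) (x : Euc d) (r : ℝ) : 0 ≤ sphAvg u x r :=
  div_nonneg (integral_nonneg fun y => hnn y) ENNReal.toReal_nonneg

lemma final_bound (D : Set (Euc d)) (lama R : ℝ) (xc : Euc d) (u : Euc d → ℝ)
    (hD : IsOpen D) (hu : MemH10 D u)
    (hnn : ∀ x, 0 ≤ u x) (hbd : ∃ M : ℝ, ∀ x, u x ≤ M) (hlip : LocLipOn D u)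
    (hsub : ∀ φ : Euc d → ℝ, TestFun D φ → (∀ x, 0 ≤ φ x) →
      (∫ x, ⟪gradient u x, gradient φ x⟫) ≤ lama * ∫ x, u x * φ x)
    (hR : 0 < R) (hball : ball xc R ⊆ D) (hxc : xc ∈ frontier (Om D u) ∩ D) :
    ∃ C > (0 : ℝ), ∀ (x₀ : Euc d) (r : ℝ), 0 < r → ball x₀ r ⊆ ball xc R →
      ∀ y ∈ ball x₀ (r / 2),
        |u y| ≤ C * (((1 / r) * sphAvg u x₀ r) * r + r ^ 2) := by
  have hd : 0 < d := by
    rcases Nat.eq_zero_or_pos d with h | h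
    · subst h
      exfalso
      have h1 : frontier (Om D u) = ∅ := by
        rcases Set.eq_empty_or_nonempty (Om D u) with h2 | ⟨z, hz⟩
        · rw [h2]; exact frontier_empty
        · have : Om D u = univ := eq_univ_of_forall fun x => by rwa [Subsingleton.elim x z]
          rw [this]; exact frontier_univ
      rw [h1] at hxc
      exact hxc.1
    · exact h
  have huc : ContinuousOn u D := by
    intro x hx
    obtain ⟨t, ht, _, K, hK⟩ := hlip x hx
    exact (hK.continuousOn.continuousAt ht).continuousWithinAt
  obtain ⟨M, hM⟩ := hbd
  have hM0 : 0 ≤ M := (hnn 0).trans (hM 0)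
  set κ := |lama| * M / (2 * d) with hκ
  have hκ0 : 0 ≤ κ := by positivity
  refine ⟨2 ^ d * (1 + κ) + 4 * M / R ^ 2, by positivity, ?_⟩
  intro x₀ r hr hsubs y hy
  have hA := sphAvg_nonneg u hnn x₀ r
  rw [abs_of_nonneg (hnn y), show (1 / r) * sphAvg u x₀ r * r = sphAvg u x₀ r by field_simp]
  set A := sphAvg u x₀ r with hAd
  have hK1 : 0 ≤ 4 * M / R ^ 2 := by positivity
  have hK2 : (0:ℝ) ≤ 2 ^ d * (1 + κ) := by positivity
  rcases le_or_gt (R / 2) r with hrR | hrR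
  · have h1 : M ≤ 4 * M / R ^ 2 * r ^ 2 := by
      have : R ^ 2 / 4 ≤ r ^ 2 := by nlinarith
      rw [div_mul_eq_mul_div, le_div_iff₀ (by positivity)]
      nlinarith
    have h2 : 0 ≤ 4 * M / R ^ 2 * A := by positivity
    have h3 : 0 ≤ 2 ^ d * (1 + κ) * (A + r ^ 2) := by positivity
    linarith [hM y]
  · have hn := ball_sub_norm hd x₀ xc r R hr hsubs
    obtain ⟨p, hp⟩ := sphere_touch x₀ xc r R hr (by linarith) hn
    have h1 := limit_bound hd D hD lama M u hu hnn hM huc hsub x₀ r hr (hsubs.trans hball) p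
      (fun z hz => (hp z hz).imp (fun h => hball h) id) y hy
    rw [← hκ, ← hAd] at h1
    have h2 : (2:ℝ) ^ d * (A + κ * r ^ 2) ≤ 2 ^ d * (1 + κ) * (A + r ^ 2) := by
      rw [mul_assoc]
      refine mul_le_mul_of_nonneg_left ?_ (by positivity)
      nlinarith [mul_nonneg hκ0 hA, sq_nonneg r]
    have h3 : 0 ≤ 4 * M / R ^ 2 * (A + r ^ 2) := by positivity
    linarith

/-- Sup bound: with `γ = (1/r)·⨍_{∂B(x₀,r)} u`, there is a constant `C`
(depending only on `a, d, D, u, B`) with `‖u‖_{L^∞(B(x₀,r/2))} ≤ C(γr + r²)` for every ball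
`B(x₀,r) ⊆ B`. -/
theorem sup_bound_from_sphere_average
    {d : ℕ} (D : Set (Euc d)) (a lama R : ℝ) (xc : Euc d) (u : Euc d → ℝ)
    (hD : IsOpen D) (hDb : Bornology.IsBounded D) (hDc : IsConnected D)
    (ha : 0 < a) (ha' : a < mvol D)
    (hlam : lama = lamOpt D a) (hu : IsJMinimizer D a lama u)
    (hnn : ∀ x, 0 ≤ u x) (hbd : ∃ M : ℝ, ∀ x, u x ≤ M) (hlip : LocLipOn D u)
    (hsub : ∀ φ : Euc d → ℝ, TestFun D φ → (∀ x, 0 ≤ φ x) →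
      (∫ x, ⟪gradient u x, gradient φ x⟫) ≤ lama * ∫ x, u x * φ x)
    (hR : 0 < R) (hball : ball xc R ⊆ D) (hxc : xc ∈ frontier (Om D u) ∩ D) :
    ∃ C > (0 : ℝ), ∀ (x₀ : Euc d) (r : ℝ), 0 < r → ball x₀ r ⊆ ball xc R →
      ∀ y ∈ ball x₀ (r / 2),
        |u y| ≤ C * (((1 / r) * sphAvg u x₀ r) * r + r ^ 2) :=
  final_bound D lama R xc u hD hu.1 hnn hbd hlip hsub hR hball hxc

end
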